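/- arXiv:2501.00567 — 3 statements merged into one kernel-verified Lean document; each statement's English description precedes it below -/
import Mathlib

section
/- Every finite triangle-free simple graph G with at least one vertex admits a probability distribution p on its independent sets under which every vertex of G is covered with probability at least f(ρ(G)), where ρ(G) is the spectral radius of the adjacency matrix of G; equivalently, the fractional chromatic number of G is at most 1/f(ρ(G)), and hence at most (1 + o(1))·ρ(G)/ln ρ(G) as ρ(G) → ∞. -/
open Finset

/-- The Shearer function: `f x = ((1-x) + x·ln x)/(x-1)²` for `x ∈ (0,∞)\{1}`,
`f 1 = 1/2`, and `f x = 1` for `x ≤ 0`. -/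
noncomputable def shearerF (x : ℝ) : ℝ :=
  if x ≤ 0 then 1
  else if x = 1 then 1 / 2
  else ((1 - x) + x * Real.log x) / (x - 1) ^ 2

/-- `I` is an independent set of `G`: no two of its vertices are adjacent. -/
def IsIndepFinset {V : Type*} (G : SimpleGraph V) (I : Finset V) : Prop :=
  ∀ u ∈ I, ∀ v ∈ I, ¬ G.Adj u v

/-- The spectral radius of a finite simple graph: the supremum of the absolute values
of the real eigenvalues of its adjacency matrix. -/
noncomputable def graphSpectralRadius {V : Type*} [Fintype V] [DecidableEq V]
    (G : SimpleGraph V) [DecidableRel G.Adj] : ℝ :=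
  sSup {r : ℝ | ∃ μ : ℝ, r = |μ| ∧
    ∃ x : V → ℝ, x ≠ 0 ∧ (G.adjMatrix ℝ).mulVec x = μ • x}

noncomputable def shF (x : ℝ) : ℝ := ∫ s in (0:ℝ)..1, (1 - s) / (1 - s + x * s)

noncomputable def shD (x : ℝ) : ℝ := ∫ s in (0:ℝ)..1, -((1 - s) * s) / (1 - s + x * s) ^ 2

lemma sh_den_pos {x s : ℝ} (hx : 0 < x) (h0 : 0 ≤ s) (h1 : s ≤ 1) : 0 < 1 - s + x * s := by
  rcases eq_or_lt_of_le h0 with h | h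
  · subst h; norm_num
  · have := mul_pos hx h
    linarith

lemma shF_int {x : ℝ} (hx : 0 < x) :
    IntervalIntegrable (fun s : ℝ => (1 - s) / (1 - s + x * s)) MeasureTheory.volume 0 1 := by
  apply ContinuousOn.intervalIntegrable
  apply ContinuousOn.div (by fun_prop) (by fun_prop)
  intro s hs
  rw [Set.uIcc_of_le zero_le_one] at hs
  exact (sh_den_pos hx hs.1 hs.2).ne'

lemma shD_int {x : ℝ} (hx : 0 < x) :
    IntervalIntegrable (fun s : ℝ => -((1 - s) * s) / (1 - s + x * s) ^ 2)
      MeasureTheory.volume 0 1 := by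
  apply ContinuousOn.intervalIntegrable
  apply ContinuousOn.div (by fun_prop) (by fun_prop)
  intro s hs
  rw [Set.uIcc_of_le zero_le_one] at hs
  exact (pow_pos (sh_den_pos hx hs.1 hs.2) 2).ne'

lemma shearerF_eq {x : ℝ} (hx : 0 < x) : shearerF x = shF x := by
  unfold shearerF shF
  rw [if_neg (not_le.2 hx)]
  split_ifs with h1
  · subst h1
    have : ∀ s : ℝ, (1 - s) / (1 - s + 1 * s) = 1 - s := by
      intro s; rw [show 1 - s + 1 * s = 1 by ring, div_one]
    simp only [this]
    rw [intervalIntegral.integral_sub (by simp) (by simp)]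
    simp
    norm_num
  · have ha : x - 1 ≠ 0 := sub_ne_zero.2 h1
    have key := intervalIntegral.integral_eq_sub_of_hasDerivAt
      (f := fun s : ℝ => -s / (x - 1) + x / (x - 1) ^ 2 * Real.log (1 - s + x * s))
      (f' := fun s : ℝ => (1 - s) / (1 - s + x * s)) (a := 0) (b := 1) ?_ (shF_int hx)
    · rw [key]
      simp
      field_simp
      ring
    · intro s hs
      rw [Set.uIcc_of_le zero_le_one] at hs
      have hp := sh_den_pos hx hs.1 hs.2
      have h2 : HasDerivAt (fun s : ℝ => 1 - s + x * s) (-1 + x * 1) s :=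
        ((hasDerivAt_id s).const_sub 1).add ((hasDerivAt_id s).const_mul x)
      have h3 := (((hasDerivAt_id s).neg).div_const (x - 1)).add
        ((h2.log hp.ne').const_mul (x / (x - 1) ^ 2))
      refine h3.congr_deriv ?_
      field_simp
      ring

lemma sh_ode_pos {x : ℝ} (hx : 0 < x) : x * (x - 1) * shD x + (x + 1) * shF x = 1 := by
  unfold shD shF
  rw [← intervalIntegral.integral_const_mul, ← intervalIntegral.integral_const_mul,
    ← intervalIntegral.integral_add ((shD_int hx).const_mul _) ((shF_int hx).const_mul _)]
  have key := intervalIntegral.integral_eq_sub_of_hasDerivAt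
      (f := fun s : ℝ => -(1 - s) ^ 2 / (1 - s + x * s))
      (f' := fun s : ℝ => x * (x - 1) * (-((1 - s) * s) / (1 - s + x * s) ^ 2)
        + (x + 1) * ((1 - s) / (1 - s + x * s))) (a := 0) (b := 1) ?_
      (((shD_int hx).const_mul _).add ((shF_int hx).const_mul _))
  · rw [key]; simp
  · intro s hs
    rw [Set.uIcc_of_le zero_le_one] at hs
    have hp := sh_den_pos hx hs.1 hs.2
    have h2 : HasDerivAt (fun s : ℝ => 1 - s + x * s) (-1 + x * 1) s :=
      ((hasDerivAt_id s).const_sub 1).add ((hasDerivAt_id s).const_mul x)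
    have h3 := ((((hasDerivAt_id s).const_sub 1).pow 2).neg).div h2 hp.ne'
    refine h3.congr_deriv ?_
    simp
    field_simp
    ring

lemma sh_ode {x : ℝ} (hx : 0 ≤ x) :
    x * (x - 1) * shD x + (x + 1) * shearerF x = 1 := by
  rcases eq_or_lt_of_le hx with h | h
  · subst h; simp [shearerF]
  · rw [shearerF_eq h]; exact sh_ode_pos h

lemma sh_tangent {x y : ℝ} (hx : 0 < x) (hy : 0 ≤ y) :
    shearerF x + shD x * (y - x) ≤ shearerF y := by
  rw [shearerF_eq hx]
  have e : shF x + shD x * (y - x) = ∫ s in (0:ℝ)..1,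
      ((1 - s) / (1 - s + x * s) + (-((1 - s) * s) / (1 - s + x * s) ^ 2) * (y - x)) := by
    rw [intervalIntegral.integral_add (shF_int hx) ((shD_int hx).mul_const _),
      intervalIntegral.integral_mul_const]
    rfl
  have hI := (shF_int hx).add ((shD_int hx).mul_const (y - x))
  rw [e]
  rcases eq_or_lt_of_le hy with h | h
  · subst h
    have : shearerF 0 = ∫ s in (0:ℝ)..1, (1:ℝ) := by simp [shearerF]
    rw [this]
    apply intervalIntegral.integral_mono_on zero_le_one hI (by simp)
    intro s hs
    have hp := sh_den_pos hx hs.1 hs.2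
    have : (1 - s) / (1 - s + x * s) + (-((1 - s) * s) / (1 - s + x * s) ^ 2) * (0 - x)
      = 1 - (x * s) ^ 2 / (1 - s + x * s) ^ 2 := by
      have hp' := hp.ne'
      rw [eq_sub_iff_add_eq, div_mul_eq_mul_div, div_add_div _ _ hp' (pow_ne_zero 2 hp'),
        div_add_div _ _ (mul_ne_zero hp' (pow_ne_zero 2 hp')) (pow_ne_zero 2 hp'),
        div_eq_one_iff_eq (mul_ne_zero (mul_ne_zero hp' (pow_ne_zero 2 hp')) (pow_ne_zero 2 hp'))]
      ring
    rw [this]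
    have : 0 ≤ (x * s) ^ 2 / (1 - s + x * s) ^ 2 := by positivity
    linarith
  · rw [shearerF_eq h]
    apply intervalIntegral.integral_mono_on zero_le_one hI (shF_int h)
    intro s hs
    have hp := sh_den_pos hx hs.1 hs.2
    have hq := sh_den_pos h hs.1 hs.2
    have e2 : (1 - s) / (1 - s + y * s) - ((1 - s) / (1 - s + x * s)
        + (-((1 - s) * s) / (1 - s + x * s) ^ 2) * (y - x))
      = (1 - s) * (s * (y - x)) ^ 2 / ((1 - s + x * s) ^ 2 * (1 - s + y * s)) := by
      have hp' := hp.ne'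
      have hq' := hq.ne'
      rw [div_mul_eq_mul_div, div_add_div _ _ hp' (pow_ne_zero 2 hp'),
        div_sub_div _ _ hq' (mul_ne_zero hp' (pow_ne_zero 2 hp')),
        div_eq_div_iff (mul_ne_zero hq' (mul_ne_zero hp' (pow_ne_zero 2 hp')))
          (mul_ne_zero (pow_ne_zero 2 hp') hq')]
      ring
    have h1s : 0 ≤ 1 - s := by linarith [hs.2]
    have : 0 ≤ (1 - s) * (s * (y - x)) ^ 2 / ((1 - s + x * s) ^ 2 * (1 - s + y * s)) := by
      positivity
    linarith

lemma shD_nonpos {x : ℝ} (hx : 0 < x) : shD x ≤ 0 := by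
  have : shD x ≤ ∫ s in (0:ℝ)..1, (0:ℝ) := by
    apply intervalIntegral.integral_mono_on zero_le_one (shD_int hx) (by simp)
    intro s hs
    have h1s : 0 ≤ 1 - s := by linarith [hs.2]
    have := hs.1
    apply div_nonpos_of_nonpos_of_nonneg
    · have := mul_nonneg h1s hs.1; linarith
    · positivity
  simpa using this

lemma sh_anti {x y : ℝ} (hx : 0 ≤ x) (hxy : x ≤ y) : shearerF y ≤ shearerF x := by
  rcases eq_or_lt_of_le hxy with h | h
  · rw [h]
  · have hy : 0 < y := lt_of_le_of_lt hx h
    have := sh_tangent hy hx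
    have h2 := mul_nonneg_of_nonpos_of_nonpos (shD_nonpos hy) (sub_nonpos.2 hxy)
    linarith

lemma sh_hasDerivAt {x : ℝ} (hx : 0 < x) : HasDerivAt shearerF (shD x) x := by
  have h : HasDerivAt shF (shD x) x := by
    have := intervalIntegral.hasDerivAt_integral_of_dominated_loc_of_deriv_le
      (μ := MeasureTheory.volume) (a := 0) (b := 1)
      (F := fun x s : ℝ => (1 - s) / (1 - s + x * s))
      (F' := fun x s : ℝ => -((1 - s) * s) / (1 - s + x * s) ^ 2) (x₀ := x)
      (s := Set.Ioi (x / 2)) (bound := fun s => ((1 - s) * s) / (1 - s + (x / 2) * s) ^ 2)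
      (Ioi_mem_nhds (by linarith)) ?_ (shF_int hx) ?_ ?_ ?_ ?_
    · exact this.2
    · filter_upwards [Ioi_mem_nhds hx] with y hy
      exact (intervalIntegrable_iff.1 (shF_int hy)).aestronglyMeasurable
    · exact (intervalIntegrable_iff.1 (shD_int hx)).aestronglyMeasurable
    · refine Filter.Eventually.of_forall fun s hs y hy => ?_
      rw [Set.uIoc_of_le zero_le_one] at hs
      have hy' : x / 2 < y := hy
      have h1s : 0 ≤ 1 - s := by linarith [hs.2]
      have hs0 := hs.1
      have hp := sh_den_pos (half_pos hx) hs.1.le hs.2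
      have hq : 1 - s + (x / 2) * s ≤ 1 - s + y * s := by nlinarith
      rw [neg_div, norm_neg, Real.norm_of_nonneg (by positivity)]
      gcongr
    · have := (shD_int (half_pos hx)).neg
      refine this.congr ?_
      intro s hs
      simp [neg_div]
    · refine Filter.Eventually.of_forall fun s hs y hy => ?_
      rw [Set.uIoc_of_le zero_le_one] at hs
      have hy' : x / 2 < y := hy
      have hp := sh_den_pos (x := y) (by linarith) hs.1.le hs.2
      have h2 : HasDerivAt (fun y : ℝ => 1 - s + y * s) (1 * s) y :=
        ((hasDerivAt_id y).mul_const s).const_add (1 - s)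
      have h3 := (hasDerivAt_const y (1 - s)).div h2 hp.ne'
      refine h3.congr_deriv ?_
      field_simp
      ring
  refine h.congr_of_eventuallyEq ?_
  filter_upwards [Ioi_mem_nhds hx] with y hy
  exact shearerF_eq hy

lemma sh_bound {x : ℝ} (hx : 2 ≤ x) : shearerF x ≤ 8 / Real.sqrt x := by
  unfold shearerF
  rw [if_neg (by linarith), if_neg (by linarith)]
  have h0 : 0 < x := by linarith
  have hs : 0 < Real.sqrt x := Real.sqrt_pos.2 h0
  have hl : Real.log x ≤ 2 * Real.sqrt x := by
    have h1 : Real.log x = 2 * Real.log (Real.sqrt x) := by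
      rw [Real.log_sqrt h0.le]; ring
    have := Real.log_le_sub_one_of_pos hs
    linarith
  rw [div_le_div_iff₀ (by nlinarith) hs]
  have hsq : Real.sqrt x * Real.sqrt x = x := Real.mul_self_sqrt h0.le
  have h3 : (1 - x + x * Real.log x) * Real.sqrt x ≤ (x * (2 * Real.sqrt x)) * Real.sqrt x := by
    apply mul_le_mul_of_nonneg_right _ hs.le
    nlinarith
  nlinarith

lemma sh_cutoff {ε : ℝ} (hε : 0 < ε) : ∃ C : ℝ, 0 < C ∧ ∀ x, ε ≤ shearerF x → x ≤ C := by
  refine ⟨2 + (8 / ε) ^ 2, by positivity, fun x hx => ?_⟩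
  by_contra hc
  push Not at hc
  have hx2 : 2 ≤ x := by nlinarith [sq_nonneg (8 / ε)]
  have h1 := sh_bound hx2
  have h2 : 8 / ε < Real.sqrt x := by
    apply Real.lt_sqrt_of_sq_lt; linarith
  have h3 : 8 / Real.sqrt x < ε := by
    rw [div_lt_iff₀ (by positivity)] at h2
    rw [div_lt_iff₀ (Real.sqrt_pos.2 (by linarith))]
    linarith
  linarith

section core

set_option linter.unusedSectionVars false

variable {V : Type*} [Fintype V] [DecidableEq V]

noncomputable def sdg (e : V → V → ℝ) (S : Finset V) (x : V → ℝ) (u : V) : ℝ :=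
  (∑ z ∈ S, e u z * x z) / x u

noncomputable def sPh (e : V → V → ℝ) (w : V → ℝ) (S : Finset V) (x : V → ℝ) : ℝ :=
  ∑ u ∈ S, w u * shearerF (sdg e S x u)

lemma sdg_nonneg {e : V → V → ℝ} (he : ∀ u v, 0 ≤ e u v) (S : Finset V) {x : V → ℝ}
    (hx : ∀ v, 0 < x v) (u : V) : 0 ≤ sdg e S x u :=
  div_nonneg (Finset.sum_nonneg fun z _ => mul_nonneg (he u z) (hx z).le) (hx u).le

/-- Averaging step at a stationary point. -/
lemma core_step {e : V → V → ℝ} (h01 : ∀ u v, e u v = 0 ∨ e u v = 1)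
    (hsymm : ∀ u v, e u v = e v u) (hirr : ∀ u, e u u = 0)
    (htri : ∀ u v z, e u v * (e u z * e v z) = 0)
    {w : V → ℝ} (hw : ∀ v, 0 ≤ w v) {S : Finset V} (hS : S.Nonempty) {x : V → ℝ}
    (hx : ∀ v, 0 < x v)
    (hst : ∀ u ∈ S, ∀ z ∈ S, e u z * (w u * shD (sdg e S x u) / x u ^ 2)
      = e u z * (w z * shD (sdg e S x z) / x z ^ 2)) :
    ∃ v ∈ S, sPh e w S x ≤ w v + sPh e w (S.filter (fun u => u ≠ v ∧ e v u = 0)) x := by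
  classical
  have he : ∀ u v, 0 ≤ e u v := fun u v => by rcases h01 u v with h | h <;> rw [h]; norm_num
  have hsq : ∀ u v, e u v * e u v = e u v := fun u v => by rcases h01 u v with h | h <;> rw [h] <;> norm_num
  set f : V → ℝ := fun u => shearerF (sdg e S x u) with hf
  set D : V → ℝ := fun u => shD (sdg e S x u) with hD
  set N : V → ℝ := fun u => ∑ z ∈ S, e u z * x z with hN
  set K : V → V → ℝ := fun u v => ∑ z ∈ S, e u z * e v z * x z with hK
  set R : V → ℝ := fun v => w v - w v * f v - ∑ u ∈ S, e v u * (w u * f u)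
    - ∑ u ∈ S, w u * D u * K u v / x u + w v * D v * N v / x v with hR
  have hd : ∀ u, sdg e S x u = N u / x u := fun u => rfl
  have low : ∀ v ∈ S, R v ≤ w v + sPh e w (S.filter (fun u => u ≠ v ∧ e v u = 0)) x
      - sPh e w S x := by
    intro v hv
    have h1 : ∑ u ∈ S.filter (fun u => u ≠ v ∧ e v u = 0), (w u * f u - w u * D u * K u v / x u)
        ≤ sPh e w (S.filter (fun u => u ≠ v ∧ e v u = 0)) x := by
      apply Finset.sum_le_sum
      intro u hu
      rw [Finset.mem_filter] at hu
      obtain ⟨huS, huv, hev⟩ := hu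
      set S' := S.filter (fun u => u ≠ v ∧ e v u = 0) with hS'
      have hdd : sdg e S' x u = sdg e S x u - K u v / x u := by
        unfold sdg
        rw [← sub_div]
        congr 1
        rw [hS', Finset.sum_filter, hK, ← Finset.sum_sub_distrib]
        apply Finset.sum_congr rfl
        intro z hz
        by_cases hzv : z = v
        · subst hzv
          have : e u z = 0 := by rw [hsymm]; exact hev
          simp [this]
        · rcases h01 v z with h | h
          · simp [hzv, h]
          · simp [h]
      have hpos' : 0 ≤ sdg e S' x u := sdg_nonneg he S' hx u
      rcases eq_or_lt_of_le (sdg_nonneg he S hx u) with h0 | h0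
      · have hK0 : 0 ≤ K u v / x u := div_nonneg
          (Finset.sum_nonneg fun z _ => mul_nonneg (mul_nonneg (he _ _) (he _ _)) (hx z).le) (hx u).le
        have hKz : K u v / x u = 0 := by linarith
        have : sdg e S' x u = sdg e S x u := by rw [hdd, hKz, sub_zero]
        rw [this, mul_div_assoc, hKz]
        simp [hf]
      · have := mul_le_mul_of_nonneg_left (sh_tangent h0 hpos') (hw u)
        rw [hdd] at this ⊢
        simp only [hf, hD]
        refine le_trans (le_of_eq ?_) this
        ring
    have h2 : ∑ u ∈ S.filter (fun u => u ≠ v ∧ e v u = 0), (w u * f u - w u * D u * K u v / x u)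
        = ∑ u ∈ S, (w u * f u - e v u * (w u * f u) - w u * D u * K u v / x u
          - if u = v then w v * f v - w v * D v * N v / x v else 0) := by
      rw [Finset.sum_filter]
      apply Finset.sum_congr rfl
      intro u hu
      by_cases huv : u = v
      · subst huv
        have : K u u = N u := by
          simp only [hK, hN, hsq]
        simp [hirr, this]
      · rcases h01 v u with h | h
        · simp [huv, h]
        · have : K u v = 0 := by
            apply Finset.sum_eq_zero
            intro z hz
            have := htri v u z
            rw [h] at this
            have h3 : e u z * e v z = 0 := by linarith
            rw [h3, zero_mul]
          simp [huv, h, this]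
    rw [h2] at h1
    simp only [Finset.sum_sub_distrib] at h1
    rw [Finset.sum_ite_eq' S v, if_pos hv] at h1
    have h3 : sPh e w S x = ∑ u ∈ S, w u * f u := rfl
    rw [h3]
    simp only [hR]
    linarith
  have tot : ∑ v ∈ S, x v * R v = 0 := by
    have e1 : ∑ v ∈ S, x v * ∑ u ∈ S, e v u * (w u * f u) = ∑ u ∈ S, w u * f u * N u := by
      simp only [Finset.mul_sum, hN]
      rw [Finset.sum_comm]
      refine Finset.sum_congr rfl fun u _ => Finset.sum_congr rfl fun v _ => ?_
      rw [hsymm v u]; ring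
    have e2 : ∑ v ∈ S, x v * ∑ u ∈ S, w u * D u * K u v / x u
        = ∑ z ∈ S, w z * D z / x z * N z ^ 2 := by
      have s1 : ∑ v ∈ S, x v * ∑ u ∈ S, w u * D u * K u v / x u
          = ∑ u ∈ S, ∑ z ∈ S, e u z * (w u * D u / x u ^ 2) * (x u * x z * N z) := by
        simp only [Finset.mul_sum]
        rw [Finset.sum_comm]
        refine Finset.sum_congr rfl fun u _ => ?_
        have : ∀ v, x v * (w u * D u * K u v / x u)
            = ∑ z ∈ S, (w u * D u / x u ^ 2 * x u * e u z * x z) * (e z v * x v) := by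
          intro v
          simp only [hK]
          rw [Finset.mul_sum, Finset.sum_div, Finset.mul_sum]
          refine Finset.sum_congr rfl fun z _ => ?_
          rw [hsymm v z]
          have := (hx u).ne'
          field_simp
        simp only [this]
        rw [Finset.sum_comm]
        refine Finset.sum_congr rfl fun z _ => ?_
        rw [← Finset.mul_sum]
        ring
      rw [s1, Finset.sum_comm]
      refine Finset.sum_congr rfl fun z hz => ?_
      have : ∀ u ∈ S, e u z * (w u * D u / x u ^ 2) * (x u * x z * N z)
          = (w z * D z / x z * N z) * (e z u * x u) := by
        intro u hu
        have h5 : e u z * (w u * D u / x u ^ 2) = e u z * (w z * D z / x z ^ 2) := hst u hu z hz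
        rw [h5, hsymm u z]
        have := (hx z).ne'
        field_simp
      rw [Finset.sum_congr rfl this, ← Finset.mul_sum]
      simp only [hN]; ring
    have e3 : ∑ v ∈ S, x v * R v = ∑ v ∈ S, (x v * w v - x v * (w v * f v))
        - ∑ v ∈ S, x v * ∑ u ∈ S, e v u * (w u * f u)
        - ∑ v ∈ S, x v * ∑ u ∈ S, w u * D u * K u v / x u + ∑ v ∈ S, w v * D v * N v := by
      rw [← Finset.sum_sub_distrib, ← Finset.sum_sub_distrib, ← Finset.sum_add_distrib]
      refine Finset.sum_congr rfl fun v _ => ?_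
      simp only [hR]
      have := (hx v).ne'
      have h6 : x v * (w v * D v * N v / x v) = w v * D v * N v := by field_simp
      rw [mul_add, h6]; ring
    rw [e3, e1, e2, ← Finset.sum_sub_distrib, ← Finset.sum_sub_distrib, ← Finset.sum_add_distrib]
    apply Finset.sum_eq_zero
    intro u hu
    have ode := sh_ode (sdg_nonneg he S hx u)
    have hxu := (hx u).ne'
    have hNu : N u = sdg e S x u * x u := by rw [hd]; field_simp
    rw [hNu]
    change sdg e S x u * (sdg e S x u - 1) * D u + (sdg e S x u + 1) * f u = 1 at ode
    generalize sdg e S x u = d at ode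
    have h7 : w u * D u / x u * (d * x u) ^ 2 = w u * D u * d ^ 2 * x u := by field_simp
    rw [h7]
    linear_combination (-(x u * w u)) * ode
  by_contra hcon
  push Not at hcon
  have : ∑ v ∈ S, x v * R v < 0 := by
    apply Finset.sum_neg
    · intro v hv
      have h1 := low v hv
      have h2 := hcon v hv
      exact mul_neg_of_pos_of_neg (hx v) (by linarith)
    · exact hS
  linarith

/-- At a global maximum the stationarity relation holds. -/
lemma core_stationary {e : V → V → ℝ} (h01 : ∀ u v, e u v = 0 ∨ e u v = 1)
    (hsymm : ∀ u v, e u v = e v u)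
    {w : V → ℝ} {S : Finset V} {x : V → ℝ} (hx : ∀ v, 0 < x v)
    (hmax : ∀ y : V → ℝ, (∀ v, 0 < y v) → sPh e w S y ≤ sPh e w S x) :
    ∀ u ∈ S, ∀ z ∈ S, e u z * (w u * shD (sdg e S x u) / x u ^ 2)
      = e u z * (w z * shD (sdg e S x z) / x z ^ 2) := by
  classical
  have he : ∀ u v, 0 ≤ e u v := fun u v => by rcases h01 u v with h | h <;> rw [h]; norm_num
  set b : V → ℝ := fun u => w u * shD (sdg e S x u) / x u ^ 2 with hb
  set y : ℝ → V → ℝ := fun t v => x v * (1 + t * b v) with hy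
  have y0 : y 0 = x := by ext v; simp [hy]
  have hder1 : ∀ v, HasDerivAt (fun t => y t v) (x v * b v) 0 := by
    intro v
    have := (((hasDerivAt_id (0:ℝ)).mul_const (b v)).const_add 1).const_mul (x v)
    simpa [hy] using this
  have hder : ∀ u ∈ S, HasDerivAt (fun t => w u * shearerF (sdg e S (y t) u))
      (∑ z ∈ S, e u z * x u * x z * (b u * (b z - b u))) 0 := by
    intro u hu
    rcases eq_or_lt_of_le (sdg_nonneg he S hx u) with h0 | h0
    · have hz : ∀ z ∈ S, e u z = 0 := by
        have h1 : ∑ z ∈ S, e u z * x z = 0 := by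
          have := h0.symm
          unfold sdg at this
          rcases div_eq_zero_iff.1 this with h | h
          · exact h
          · exact absurd h (hx u).ne'
        intro z hz
        have := (Finset.sum_eq_zero_iff_of_nonneg
          (fun z _ => mul_nonneg (he u z) (hx z).le)).1 h1 z hz
        rcases mul_eq_zero.1 this with h | h
        · exact h
        · exact absurd h (hx z).ne'
      have hc : (fun t => w u * shearerF (sdg e S (y t) u)) = fun _ => w u * shearerF 0 := by
        funext t
        unfold sdg
        rw [Finset.sum_eq_zero (fun z hz' => by rw [hz z hz', zero_mul]), zero_div]
      rw [hc, Finset.sum_eq_zero (fun z hz' => by rw [hz z hz']; ring)]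
      exact hasDerivAt_const _ _
    · have hn : HasDerivAt (fun t => ∑ z ∈ S, e u z * y t z) (∑ z ∈ S, e u z * (x z * b z)) 0 :=
        HasDerivAt.fun_sum fun z _ => (hder1 z).const_mul (e u z)
      have hq := hn.div (hder1 u) (by rw [y0]; exact (hx u).ne')
      have hs : HasDerivAt shearerF (shD (sdg e S x u)) (sdg e S (y 0) u) := by
        rw [y0]; exact sh_hasDerivAt h0
      have hc := (HasDerivAt.comp (0:ℝ) hs hq).const_mul (w u)
      refine hc.congr_deriv ?_
      rw [y0]
      have hbu : w u * shD (sdg e S x u) = b u * x u ^ 2 := by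
        have := (hx u).ne'
        simp only [hb]; field_simp
      rw [← mul_assoc, hbu]
      have hxu := (hx u).ne'
      have : b u * x u ^ 2 * (((∑ z ∈ S, e u z * (x z * b z)) * x u
          - (∑ z ∈ S, e u z * x z) * (x u * b u)) / x u ^ 2)
          = b u * ((∑ z ∈ S, e u z * (x z * b z)) * x u
          - (∑ z ∈ S, e u z * x z) * (x u * b u)) := by field_simp
      rw [this, Finset.sum_mul, Finset.sum_mul, ← Finset.sum_sub_distrib, Finset.mul_sum]
      refine Finset.sum_congr rfl fun z _ => ?_
      ring
  have hsum : HasDerivAt (fun t => sPh e w S (y t))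
      (∑ u ∈ S, ∑ z ∈ S, e u z * x u * x z * (b u * (b z - b u))) 0 :=
    HasDerivAt.fun_sum hder
  have hloc : IsLocalMax (fun t => sPh e w S (y t)) 0 := by
    have hev : ∀ᶠ t in nhds (0:ℝ), ∀ v, 0 < y t v := by
      rw [Filter.eventually_all]
      intro v
      have hc : ContinuousAt (fun t => y t v) 0 := (hder1 v).continuousAt
      exact hc.eventually (lt_mem_nhds (by simpa [y0] using hx v))
    filter_upwards [hev] with t ht
    rw [y0]
    exact hmax _ ht
  have hzero := hloc.hasDerivAt_eq_zero hsum
  have hsw : ∑ u ∈ S, ∑ z ∈ S, e u z * x u * x z * (b u * (b z - b u))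
      = ∑ u ∈ S, ∑ z ∈ S, e u z * x u * x z * (b z * (b u - b z)) := by
    rw [Finset.sum_comm]
    refine Finset.sum_congr rfl fun u _ => Finset.sum_congr rfl fun z _ => ?_
    rw [hsymm z u]; ring
  have hsq : ∑ u ∈ S, ∑ z ∈ S, e u z * x u * x z * (b u - b z) ^ 2 = 0 := by
    have : ∑ u ∈ S, ∑ z ∈ S, e u z * x u * x z * (b u - b z) ^ 2
        = -(∑ u ∈ S, ∑ z ∈ S, e u z * x u * x z * (b u * (b z - b u)))
        - ∑ u ∈ S, ∑ z ∈ S, e u z * x u * x z * (b z * (b u - b z)) := by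
      simp only [← Finset.sum_neg_distrib, ← Finset.sum_sub_distrib]
      refine Finset.sum_congr rfl fun u _ => Finset.sum_congr rfl fun z _ => ?_
      ring
    rw [this, ← hsw, hzero]; simp
  intro u hu z hz
  have hnn : ∀ u z, 0 ≤ e u z * x u * x z * (b u - b z) ^ 2 := fun u z =>
    mul_nonneg (mul_nonneg (mul_nonneg (he u z) (hx u).le) (hx z).le) (sq_nonneg _)
  have h1 := (Finset.sum_eq_zero_iff_of_nonneg
    (fun u _ => Finset.sum_nonneg fun z _ => hnn u z)).1 hsq u hu
  have h2 := (Finset.sum_eq_zero_iff_of_nonneg (fun z _ => hnn u z)).1 h1 z hz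
  change e u z * b u = e u z * b z
  rcases h01 u z with h | h
  · rw [h]; ring
  · rw [h] at h2 ⊢
    have hxx := mul_pos (hx u) (hx z)
    have h3 : (b u - b z) ^ 2 = 0 := by
      rcases mul_eq_zero.1 h2 with h | h
      · exfalso; nlinarith
      · exact h
    have := pow_eq_zero_iff (two_ne_zero) |>.1 h3
    linarith


/-- If all admissible points have bounded degrees, a global maximum of `sPh` exists. -/
lemma core_max {e : V → V → ℝ} (h01 : ∀ u v, e u v = 0 ∨ e u v = 1)
    (hsymm : ∀ u v, e u v = e v u)
    {w : V → ℝ} {S : Finset V} {x₀ : V → ℝ} (hx₀ : ∀ v, 0 < x₀ v) {C : ℝ} (hC : 0 < C)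
    (hbd : ∀ x : V → ℝ, (∀ v, 0 < x v) → sPh e w S x₀ ≤ sPh e w S x →
      ∀ u ∈ S, sdg e S x u ≤ C) :
    ∃ x : V → ℝ, (∀ v, 0 < x v) ∧ ∀ y : V → ℝ, (∀ v, 0 < y v) → sPh e w S y ≤ sPh e w S x := by
  classical
  have he : ∀ u v, 0 ≤ e u v := fun u v => by rcases h01 u v with h | h <;> rw [h]; norm_num
  set P : (V → ℝ) → Prop := fun x => (∀ v, 0 < x v) ∧ sPh e w S x₀ ≤ sPh e w S x with hP
  let r : V → V → Prop := fun u v => u ∈ S ∧ v ∈ S ∧ e u v = 1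
  have hedge : ∀ x, P x → ∀ u v, r u v → x v ≤ C * x u := by
    intro x hx u v ⟨hu, hv, huv⟩
    have h1 := hbd x hx.1 hx.2 u hu
    unfold sdg at h1
    rw [div_le_iff₀ (hx.1 u)] at h1
    refine le_trans ?_ h1
    have := Finset.single_le_sum (f := fun z => e u z * x z)
      (fun z _ => mul_nonneg (he u z) (hx.1 z).le) hv
    simpa [huv] using this
  have hreach : ∀ u v, Relation.EqvGen r u v →
      ∃ K : ℝ, 0 < K ∧ ∀ x, P x → x v ≤ K * x u ∧ x u ≤ K * x v := by
    intro u v h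
    induction h with
    | rel u v h =>
      refine ⟨C, hC, fun x hx => ⟨hedge x hx u v h, hedge x hx v u ⟨h.2.1, h.1, ?_⟩⟩⟩
      rw [hsymm]; exact h.2.2
    | refl u => exact ⟨1, one_pos, fun x hx => by simp⟩
    | symm u v _ ih =>
      obtain ⟨K, hK, h⟩ := ih
      exact ⟨K, hK, fun x hx => ⟨(h x hx).2, (h x hx).1⟩⟩
    | trans u v z _ _ ih1 ih2 =>
      obtain ⟨K, hK, h⟩ := ih1
      obtain ⟨K', hK', h'⟩ := ih2
      refine ⟨K * K', mul_pos hK hK', fun x hx => ⟨?_, ?_⟩⟩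
      · have a1 := (h x hx).1
        have a2 := (h' x hx).1
        have := mul_le_mul_of_nonneg_left a1 hK'.le
        linarith
      · have a1 := (h x hx).2
        have a2 := (h' x hx).2
        have := mul_le_mul_of_nonneg_left a2 hK.le
        linarith
  let rep : V → V := fun v => Quot.out (Quot.mk r v)
  have hrep : ∀ v, Relation.EqvGen r (rep v) v := fun v =>
    Quot.eqvGen_exact (Quot.out_eq (Quot.mk r v))
  have hrepe : ∀ u v, r u v → rep u = rep v := fun u v h => by
    simp only [rep]; rw [Quot.sound h]
  choose K hK hKx using fun v => hreach (rep v) v (hrep v)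
  set B : ℝ := 1 + ∑ v, K v with hB
  have hKB : ∀ v, K v ≤ B := fun v => by
    have := Finset.single_le_sum (f := K) (fun z _ => (hK z).le) (Finset.mem_univ v)
    linarith
  have hB0 : 0 < B := by
    have : 0 ≤ ∑ v, K v := Finset.sum_nonneg fun z _ => (hK z).le
    linarith
  set Q : Set (V → ℝ) := Set.pi Set.univ (fun _ => Set.Icc B⁻¹ B) with hQ
  have hQc : IsCompact Q := isCompact_univ_pi fun _ => isCompact_Icc
  have hQpos : ∀ x ∈ Q, ∀ v, 0 < x v := fun x hx v =>
    lt_of_lt_of_le (inv_pos.2 hB0) (hx v (Set.mem_univ v)).1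
  have hscale : ∀ x, P x → ∃ y ∈ Q, sPh e w S y = sPh e w S x := by
    intro x hx
    refine ⟨fun v => x v / x (rep v), ?_, ?_⟩
    · intro v _
      have hp := hx.1 (rep v)
      constructor
      · rw [inv_le_comm₀ hB0 (div_pos (hx.1 v) hp), inv_div, div_le_iff₀ (hx.1 v)]
        exact (hKx v x hx).2.trans (mul_le_mul_of_nonneg_right (hKB v) (hx.1 v).le)
      · rw [div_le_iff₀ hp]
        exact (hKx v x hx).1.trans (mul_le_mul_of_nonneg_right (hKB v) hp.le)
    · unfold sPh
      refine Finset.sum_congr rfl fun u hu => ?_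
      congr 2
      unfold sdg
      have hp := (hx.1 (rep u)).ne'
      have : ∑ z ∈ S, e u z * (x z / x (rep z)) = (∑ z ∈ S, e u z * x z) / x (rep u) := by
        rw [Finset.sum_div]
        refine Finset.sum_congr rfl fun z hz => ?_
        rcases h01 u z with h | h
        · simp [h]
        · rw [← hrepe u z ⟨hu, hz, h⟩, mul_div_assoc]
      rw [this]
      have := (hx.1 u).ne'
      field_simp
  have hcont : ContinuousOn (fun x => sPh e w S x) Q := by
    unfold sPh
    refine continuousOn_finsetSum S fun u hu => ?_
    refine ContinuousOn.mul continuousOn_const ?_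
    by_cases hz : ∀ z ∈ S, e u z = 0
    · have hc : (fun x : V → ℝ => shearerF (sdg e S x u)) = fun _ => shearerF 0 := by
        funext t
        unfold sdg
        rw [Finset.sum_eq_zero (fun z hz' => by rw [hz z hz', zero_mul]), zero_div]
      rw [hc]; exact continuousOn_const
    · push Not at hz
      obtain ⟨z, hzS, hz⟩ := hz
      have hz1 : e u z = 1 := (h01 u z).resolve_left hz
      intro x hx
      have hxp := hQpos x hx
      have hdp : 0 < sdg e S x u := by
        apply div_pos _ (hxp u)
        refine lt_of_lt_of_le (hxp z) ?_
        have := Finset.single_le_sum (f := fun z => e u z * x z)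
          (fun z _ => mul_nonneg (he u z) (hxp z).le) hzS
        simpa [hz1] using this
      have h1 : ContinuousAt (fun x : V → ℝ => sdg e S x u) x := by
        unfold sdg
        apply ContinuousAt.div
        · exact (continuous_finsetSum S fun z _ =>
            continuous_const.mul (continuous_apply z)).continuousAt
        · exact (continuous_apply u).continuousAt
        · exact (hxp u).ne'
      have h2 : ContinuousAt shearerF (sdg e S x u) := (sh_hasDerivAt hdp).continuousAt
      exact (ContinuousAt.comp (f := fun x : V → ℝ => sdg e S x u) h2 h1).continuousWithinAt
  obtain ⟨y₀, hy₀Q, hy₀⟩ := hscale x₀ ⟨hx₀, le_rfl⟩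
  obtain ⟨x, hxQ, hxm⟩ := hQc.exists_isMaxOn ⟨y₀, hy₀Q⟩ hcont
  refine ⟨x, hQpos x hxQ, fun y hy => ?_⟩
  have hx0 : sPh e w S x₀ ≤ sPh e w S x := by
    rw [← hy₀]; exact hxm hy₀Q
  rcases le_total (sPh e w S x₀) (sPh e w S y) with h | h
  · obtain ⟨y', hy'Q, hy'⟩ := hscale y ⟨hy, h⟩
    rw [← hy']; exact hxm hy'Q
  · exact h.trans hx0

/-- Weighted local Shearer bound. -/
lemma core_main {e : V → V → ℝ} (h01 : ∀ u v, e u v = 0 ∨ e u v = 1)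
    (hsymm : ∀ u v, e u v = e v u) (hirr : ∀ u, e u u = 0)
    (htri : ∀ u v z, e u v * (e u z * e v z) = 0)
    {w : V → ℝ} (hw : ∀ v, 0 ≤ w v) (S : Finset V) :
    ∀ x : V → ℝ, (∀ v, 0 < x v) →
      ∃ I ⊆ S, (∀ u ∈ I, ∀ v ∈ I, e u v = 0) ∧ sPh e w S x ≤ ∑ v ∈ I, w v := by
  classical
  have he : ∀ u v, 0 ≤ e u v := fun u v => by rcases h01 u v with h | h <;> rw [h]; norm_num
  induction S using Finset.strongInduction with
  | H S ih =>
  intro x₀ hx₀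
  rcases S.eq_empty_or_nonempty with hS | hS
  · exact ⟨∅, by simp, by simp, by simp [sPh, hS]⟩
  by_contra hcon
  push Not at hcon
  obtain ⟨I₀, hI₀, hmaxI⟩ := Finset.exists_max_image
    (S.powerset.filter fun I => ∀ u ∈ I, ∀ v ∈ I, e u v = 0) (fun I => ∑ v ∈ I, w v)
    ⟨∅, by simp⟩
  set M := ∑ v ∈ I₀, w v with hM
  have hMlt : M < sPh e w S x₀ := by
    simp only [Finset.mem_filter, Finset.mem_powerset] at hI₀
    exact hcon I₀ hI₀.1 hI₀.2
  have hMge : ∀ I ⊆ S, (∀ u ∈ I, ∀ v ∈ I, e u v = 0) → ∑ v ∈ I, w v ≤ M := by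
    intro I hI hI'
    apply hmaxI
    simp only [Finset.mem_filter, Finset.mem_powerset]
    exact ⟨hI, hI'⟩
  set δ := sPh e w S x₀ - M with hδ
  have hδ0 : 0 < δ := by linarith
  set W := 1 + ∑ v, w v with hW
  have hW0 : 0 < W := by
    have : 0 ≤ ∑ v, w v := Finset.sum_nonneg fun v _ => hw v
    linarith
  obtain ⟨C, hC, hcut⟩ := sh_cutoff (div_pos hδ0 hW0)
  have hbd : ∀ x : V → ℝ, (∀ v, 0 < x v) → sPh e w S x₀ ≤ sPh e w S x →
      ∀ u ∈ S, sdg e S x u ≤ C := by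
    intro x hx hge u hu
    apply hcut
    obtain ⟨I, hI, hI', hle⟩ := ih (S.erase u) (Finset.erase_ssubset hu) x hx
    have h1 := hMge I (hI.trans (Finset.erase_subset _ _)) hI'
    have h2 : sPh e w S x ≤ w u * shearerF (sdg e S x u) + sPh e w (S.erase u) x := by
      unfold sPh
      rw [← Finset.add_sum_erase S _ hu]
      gcongr with z hz
      · exact hw z
      · apply sh_anti (sdg_nonneg he _ hx z)
        unfold sdg
        apply div_le_div_of_nonneg_right _ (hx z).le
        exact Finset.sum_le_sum_of_subset_of_nonneg (Finset.erase_subset _ _)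
          fun v _ _ => mul_nonneg (he _ _) (hx v).le
    have h3 : δ ≤ w u * shearerF (sdg e S x u) := by linarith
    have hwu : 0 < w u := by
      rcases eq_or_lt_of_le (hw u) with h | h
      · rw [← h] at h3; linarith
      · exact h
    have hf : 0 < shearerF (sdg e S x u) := by
      by_contra hf
      push Not at hf
      have := mul_nonpos_of_nonneg_of_nonpos hwu.le hf
      linarith
    rw [div_le_iff₀ hW0]
    have hwW : w u ≤ W := by
      have := Finset.single_le_sum (f := w) (fun z _ => hw z) (Finset.mem_univ u)
      linarith
    nlinarith
  obtain ⟨x, hx, hmax⟩ := core_max h01 hsymm hx₀ hC hbd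
  obtain ⟨v, hv, hle⟩ := core_step h01 hsymm hirr htri hw hS hx
    (core_stationary h01 hsymm hx hmax)
  obtain ⟨I, hI, hI', hIle⟩ := ih (S.filter (fun u => u ≠ v ∧ e v u = 0))
    (Finset.filter_ssubset.2 ⟨v, hv, by simp⟩) x hx
  have hvI : v ∉ I := fun h => by
    have := hI h
    simp at this
  have h0 : ∀ u ∈ I, e v u = 0 := fun u hu => by
    have := hI hu
    simp only [Finset.mem_filter] at this
    exact this.2.2
  have := hcon (insert v I) (Finset.insert_subset hv (hI.trans (Finset.filter_subset _ _))) (by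
    intro a ha b hb
    rw [Finset.mem_insert] at ha hb
    rcases ha with rfl | ha <;> rcases hb with rfl | hb
    · exact hirr _
    · exact h0 _ hb
    · rw [hsymm]; exact h0 _ ha
    · exact hI' _ ha _ hb)
  rw [Finset.sum_insert hvI] at this
  have := hmax x₀ hx₀
  linarith

end core

lemma cover_duality {V : Type*} [Fintype V] [DecidableEq V] (P : Finset V → Prop) (c : ℝ)
    (h : ∀ w : V → ℝ, (∀ v, 0 ≤ w v) → ∃ I, P I ∧ c * ∑ v, w v ≤ ∑ v ∈ I, w v) :
    ∃ p : Finset V → ℝ, (∀ I, 0 ≤ p I) ∧ (∀ I, p I ≠ 0 → P I) ∧ (∑ I : Finset V, p I) = 1 ∧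
      ∀ v : V, c ≤ ∑ I ∈ Finset.univ.filter (fun I : Finset V => v ∈ I), p I := by
  classical
  let T : (Finset V → ℝ) →ₗ[ℝ] (V → ℝ) :=
    { toFun := fun p v => ∑ I ∈ Finset.univ.filter (fun I : Finset V => v ∈ I), p I
      map_add' := fun p q => by ext v; simp [Finset.sum_add_distrib]
      map_smul' := fun a p => by ext v; simp [Finset.mul_sum] }
  let Δ : Set (Finset V → ℝ) := stdSimplex ℝ (Finset V) ∩ {p | ∀ I, ¬ P I → p I = 0}
  have hcl : IsClosed {p : Finset V → ℝ | ∀ I, ¬ P I → p I = 0} := by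
    have : {p : Finset V → ℝ | ∀ I, ¬ P I → p I = 0}
        = ⋂ I, ⋂ (_ : ¬ P I), {p : Finset V → ℝ | p I = 0} := by ext p; simp
    rw [this]
    exact isClosed_iInter fun I => isClosed_iInter fun _ =>
      isClosed_eq (continuous_apply I) continuous_const
  have hΔc : IsCompact Δ := (isCompact_stdSimplex ℝ (Finset V)).inter_right hcl
  have hΔv : Convex ℝ Δ := by
    apply (convex_stdSimplex ℝ (Finset V)).inter
    intro p hp q hq a b _ _ _ I hI
    simp [hp I hI, hq I hI]
  have hTc : Continuous T := T.continuous_of_finiteDimensional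
  by_cases hdis : Disjoint (T '' Δ) {y : V → ℝ | ∀ v, c ≤ y v}
  · exfalso
    have hcl2 : IsClosed {y : V → ℝ | ∀ v, c ≤ y v} := by
      have : {y : V → ℝ | ∀ v, c ≤ y v} = ⋂ v, {y : V → ℝ | c ≤ y v} := by ext p; simp
      rw [this]
      exact isClosed_iInter fun v => isClosed_le continuous_const (continuous_apply v)
    have hcv2 : Convex ℝ {y : V → ℝ | ∀ v, c ≤ y v} := by
      intro p hp q hq a b ha hb hab v
      have h1 := mul_le_mul_of_nonneg_left (hp v) ha
      have h2 := mul_le_mul_of_nonneg_left (hq v) hb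
      have h3 : a * c + b * c = c := by rw [← add_mul, hab, one_mul]
      simp only [Pi.add_apply, Pi.smul_apply, smul_eq_mul]
      linarith
    obtain ⟨l, s, t, hs, hst, ht⟩ := geometric_hahn_banach_compact_closed
      (hΔv.linear_image T) (hΔc.image hTc) hcv2 hcl2 hdis
    set w : V → ℝ := fun v => l (Pi.single v 1) with hwdef
    have hl : ∀ y : V → ℝ, l y = ∑ v, y v * w v := by
      intro y
      conv_lhs => rw [pi_eq_sum_univ' y]
      simp only [map_sum, map_smul, smul_eq_mul, hwdef]
    have hw : ∀ v, 0 ≤ w v := by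
      intro v
      by_contra hneg
      push Not at hneg
      have key : ∀ N : ℝ, 0 ≤ N → t < l (fun _ => c) + N * w v := by
        intro N hN
        have := ht ((fun _ => c) + N • Pi.single v 1) (by
          intro u
          simp only [Pi.add_apply, Pi.smul_apply, smul_eq_mul, Pi.single_apply]
          split_ifs <;> simp [hN])
        rw [map_add, map_smul, smul_eq_mul] at this
        exact this
      have h0 := key 0 le_rfl
      have h1 := key ((l (fun _ => c) - t) / (-w v)) (div_nonneg (by linarith) (by linarith))
      have h2 : (l (fun _ => c) - t) / (-w v) * w v = -(l (fun _ => c) - t) := by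
        have := hneg.ne
        field_simp
      linarith
    obtain ⟨I, hI, hle⟩ := h w hw
    have h1 := hs (T (Pi.single I 1)) ⟨_, ⟨single_mem_stdSimplex ℝ I, fun J hJ => by
      have : J ≠ I := fun h => hJ (h ▸ hI)
      simp [Pi.single_apply, this]⟩, rfl⟩
    have h2 := ht (fun _ => c) (fun v => le_rfl)
    have h3 : l (T (Pi.single I 1)) = ∑ v ∈ I, w v := by
      rw [hl, ← Finset.sum_subset (Finset.subset_univ I)]
      · refine Finset.sum_congr rfl fun v hv => ?_
        simp [T, Pi.single_apply, Finset.sum_ite_eq', hv]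
      · intro v _ hv
        simp [T, Pi.single_apply, Finset.sum_ite_eq', hv]
    rw [hl, ← Finset.mul_sum] at h2
    linarith
  · rw [Set.not_disjoint_iff] at hdis
    obtain ⟨_, ⟨p, hp, rfl⟩, hy⟩ := hdis
    refine ⟨p, hp.1.1, fun I hI => ?_, hp.1.2, hy⟩
    by_contra hn
    exact hI (hp.2 I hn)

lemma rayleigh_le {V : Type*} [Fintype V] [DecidableEq V] (G : SimpleGraph V)
    [DecidableRel G.Adj] (y : V → ℝ) :
    ∑ u, ∑ z, G.adjMatrix ℝ u z * (y u * y z) ≤ graphSpectralRadius G * ∑ u, y u ^ 2 := by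
  classical
  set ρ := graphSpectralRadius G with hρ
  set A := G.adjMatrix ℝ with hA
  have hbdd : BddAbove {r : ℝ | ∃ μ : ℝ, r = |μ| ∧
      ∃ x : V → ℝ, x ≠ 0 ∧ A.mulVec x = μ • x} := by
    apply Set.Finite.bddAbove
    refine ((Module.End.finite_hasEigenvalue (Matrix.toLin' A)).image (fun μ => |μ|)).subset ?_
    rintro r ⟨μ, rfl, x, hx, hAx⟩
    refine ⟨μ, ?_, rfl⟩
    exact Module.End.hasEigenvalue_of_hasEigenvector (x := x)
      ⟨Module.End.mem_eigenspace_iff.2 (by rw [Matrix.toLin'_apply]; exact hAx), hx⟩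
  have hH : (ρ • (1 : Matrix V V ℝ) - A).IsHermitian := by
    apply Matrix.IsHermitian.ext
    intro i j
    simp [hA, Matrix.one_apply, SimpleGraph.adjMatrix_apply, G.adj_comm, eq_comm]
  have hpsd : (ρ • (1 : Matrix V V ℝ) - A).PosSemidef := by
    rw [hH.posSemidef_iff_eigenvalues_nonneg]
    intro i
    have h1 := hH.mulVec_eigenvectorBasis i
    set x : V → ℝ := ⇑(hH.eigenvectorBasis i) with hx
    have hx0 : x ≠ 0 := by
      intro h
      have h2 := hH.eigenvectorBasis.orthonormal.ne_zero i
      apply h2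
      ext j
      exact congrFun h j
    have h3 : A.mulVec x = (ρ - hH.eigenvalues i) • x := by
      rw [Matrix.sub_mulVec, Matrix.smul_mulVec, Matrix.one_mulVec] at h1
      rw [sub_smul, ← h1]
      abel
    have h4 : |ρ - hH.eigenvalues i| ≤ ρ := le_csSup hbdd ⟨_, rfl, x, hx0, h3⟩
    have := le_abs_self (ρ - hH.eigenvalues i)
    simp only [Pi.zero_apply]
    linarith
  have h := hpsd.dotProduct_mulVec_nonneg y
  rw [Matrix.sub_mulVec, Matrix.smul_mulVec, Matrix.one_mulVec, dotProduct_sub,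
    dotProduct_smul] at h
  have e1 : star y ⬝ᵥ y = ∑ u, y u ^ 2 := by
    simp [dotProduct, sq]
  have e2 : star y ⬝ᵥ A.mulVec y = ∑ u, ∑ z, A u z * (y u * y z) := by
    simp only [dotProduct, Matrix.mulVec, Finset.mul_sum, star_trivial]
    refine Finset.sum_congr rfl fun u _ => Finset.sum_congr rfl fun z _ => ?_
    ring
  rw [e1, e2, smul_eq_mul] at h
  linarith

/-- every finite triangle-free graph with at least one vertex has a
probability distribution on its independent sets covering every vertex with probability
at least `f(ρ(G))`, where `ρ(G)` is the spectral radius; equivalently `χ_f(G) ≤ 1/f(ρ(G))`. -/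
theorem local_shearer_spectral {V : Type*} [Fintype V] [DecidableEq V] [Nonempty V]
    (G : SimpleGraph V) [DecidableRel G.Adj] (hG : G.CliqueFree 3) :
    ∃ p : Finset V → ℝ,
      (∀ I, 0 ≤ p I) ∧
      (∀ I, p I ≠ 0 → IsIndepFinset G I) ∧
      (∑ I : Finset V, p I) = 1 ∧
      ∀ v : V,
        shearerF (graphSpectralRadius G) ≤
          ∑ I ∈ Finset.univ.filter (fun I : Finset V => v ∈ I), p I := by
  classical
  apply cover_duality
  intro w hw
  set e : V → V → ℝ := fun u v => G.adjMatrix ℝ u v with he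
  have h01 : ∀ u v, e u v = 0 ∨ e u v = 1 := fun u v => by
    simp only [he, SimpleGraph.adjMatrix_apply]; split_ifs <;> simp
  have he0 : ∀ u v, 0 ≤ e u v := fun u v => by rcases h01 u v with h | h <;> rw [h]; norm_num
  have hsymm : ∀ u v, e u v = e v u := fun u v => by
    simp [he, SimpleGraph.adjMatrix_apply, G.adj_comm]
  have hirr : ∀ u, e u u = 0 := fun u => by simp [he]
  have htri : ∀ u v z, e u v * (e u z * e v z) = 0 := by
    intro u v z
    simp only [he, SimpleGraph.adjMatrix_apply]
    by_cases h1 : G.Adj u v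
    · by_cases h2 : G.Adj u z
      · by_cases h3 : G.Adj v z
        · exact absurd (SimpleGraph.is3Clique_triple_iff.2 ⟨h1, h2, h3⟩) (hG {u, v, z})
        · simp [h3]
      · simp [h2]
    · simp [h1]
  set S : Finset V := Finset.univ.filter (fun v => 0 < w v) with hS
  set x : V → ℝ := fun v => if 0 < w v then Real.sqrt (w v) else 1 with hx
  have hxp : ∀ v, 0 < x v := fun v => by
    simp only [hx]; split_ifs with h
    · exact Real.sqrt_pos.2 h
    · exact one_pos
  obtain ⟨I, hIS, hI, hle⟩ := core_main h01 hsymm hirr htri hw S x hxp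
  refine ⟨I, fun u hu v hv hadj => ?_, le_trans ?_ hle⟩
  · have := hI u hu v hv
    simp [he, SimpleGraph.adjMatrix_apply, hadj] at this
  have hwS : ∑ v, w v = ∑ v ∈ S, w v := by
    symm
    apply Finset.sum_subset (Finset.subset_univ S)
    intro v _ hv
    simp only [hS, Finset.mem_filter, Finset.mem_univ, true_and, not_lt] at hv
    exact le_antisymm hv (hw v)
  set ρ := graphSpectralRadius G with hρ
  have hray : ∑ u ∈ S, w u * sdg e S x u ≤ ρ * ∑ u ∈ S, w u := by
    have h1 := rayleigh_le G (fun v => Real.sqrt (w v))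
    have h2 : ∑ u, Real.sqrt (w u) ^ 2 = ∑ u ∈ S, w u := by
      rw [← hwS]; exact Finset.sum_congr rfl fun u _ => Real.sq_sqrt (hw u)
    rw [h2] at h1
    refine le_trans (le_of_eq ?_) h1
    have hz : ∀ v, v ∉ S → Real.sqrt (w v) = 0 := by
      intro v hv
      simp only [hS, Finset.mem_filter, Finset.mem_univ, true_and, not_lt] at hv
      exact Real.sqrt_eq_zero_of_nonpos hv
    have hxs : ∀ v ∈ S, x v = Real.sqrt (w v) := by
      intro v hv
      simp only [hS, Finset.mem_filter, Finset.mem_univ, true_and] at hv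
      simp [hx, hv]
    rw [← Finset.sum_subset (Finset.subset_univ S)
      (fun u _ hu => Finset.sum_eq_zero fun z _ => by rw [hz u hu]; ring)]
    refine Finset.sum_congr rfl fun u hu => ?_
    rw [← Finset.sum_subset (Finset.subset_univ S) (fun z _ hz' => by rw [hz z hz']; ring)]
    have hwu : w u = x u ^ 2 := by rw [hxs u hu, Real.sq_sqrt (hw u)]
    have hxu := (hxp u).ne'
    have : w u * sdg e S x u = x u * ∑ z ∈ S, e u z * x z := by
      unfold sdg; rw [hwu]; field_simp
    rw [this, Finset.mul_sum]
    refine Finset.sum_congr rfl fun z hz' => ?_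
    rw [hxs u hu, hxs z hz']
    simp only [he]; ring
  have hdn : ∀ u, 0 ≤ sdg e S x u := sdg_nonneg he0 S hxp
  rw [hwS]
  unfold sPh
  rcases le_or_gt ρ 0 with hρ0 | hρ0
  · have hsum0 : ∑ u ∈ S, w u * sdg e S x u ≤ 0 := hray.trans
      (mul_nonpos_of_nonpos_of_nonneg hρ0 (Finset.sum_nonneg fun u _ => hw u))
    have hnn : ∀ u ∈ S, 0 ≤ w u * sdg e S x u := fun u _ => mul_nonneg (hw u) (hdn u)
    have hz := (Finset.sum_eq_zero_iff_of_nonneg hnn).1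
      (le_antisymm hsum0 (Finset.sum_nonneg hnn))
    rw [Finset.mul_sum]
    refine Finset.sum_le_sum fun u hu => ?_
    have hwu : 0 < w u := by simpa [hS] using hu
    have hd0 : sdg e S x u = 0 := (mul_eq_zero.1 (hz u hu)).resolve_left hwu.ne'
    rw [hd0]
    have : shearerF ρ = shearerF 0 := by simp [shearerF, hρ0]
    rw [this, mul_comm]
  · have h1 : ∑ u ∈ S, w u * (shearerF ρ + shD ρ * (sdg e S x u - ρ))
        ≤ ∑ u ∈ S, w u * shearerF (sdg e S x u) :=
      Finset.sum_le_sum fun u _ => mul_le_mul_of_nonneg_left (sh_tangent hρ0 (hdn u)) (hw u)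
    refine le_trans ?_ h1
    have h2 : ∑ u ∈ S, w u * (shearerF ρ + shD ρ * (sdg e S x u - ρ))
        = shearerF ρ * ∑ u ∈ S, w u
          + shD ρ * (∑ u ∈ S, w u * sdg e S x u - ρ * ∑ u ∈ S, w u) := by
      rw [mul_sub, Finset.mul_sum, Finset.mul_sum, Finset.mul_sum, Finset.mul_sum,
        ← Finset.sum_sub_distrib, ← Finset.sum_add_distrib]
      refine Finset.sum_congr rfl fun u _ => ?_
      ring
    rw [h2]
    have := mul_nonneg_of_nonpos_of_nonpos (shD_nonpos hρ0) (sub_nonpos.2 hray)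
    linarith
end

section
/- Every finite triangle-free simple graph G contains an independent set of size at least Σ_{v ∈ V(G)} f(d_G(v)), where d_G(v) is the degree of v in G. -/
open Finset

namespace ShearerAux

open intervalIntegral

lemma h_pos (c t : ℝ) (hc : 0 ≤ c) (ht : t ∈ Set.Icc (0:ℝ) 1) : 0 < 1 + c * t := by
  have := mul_nonneg hc ht.1
  linarith

lemma cont (c : ℝ) (hc : 0 ≤ c) :
    ContinuousOn (fun t : ℝ => (1 - t) / (1 + c * t)) (Set.uIcc 0 1) := by
  rw [Set.uIcc_of_le zero_le_one]
  apply ContinuousOn.div (by fun_prop) (by fun_prop)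
  intro t ht
  exact (h_pos c t hc ht).ne'

lemma integ (c : ℝ) (hc : 0 ≤ c) :
    IntervalIntegrable (fun t : ℝ => (1 - t) / (1 + c * t)) MeasureTheory.volume 0 1 :=
  (cont c hc).intervalIntegrable

/-- Integral representation of the Shearer function. -/
lemma F_eq (c : ℝ) (hc : 0 ≤ c) :
    shearerF (c + 1) = ∫ t in (0:ℝ)..1, (1 - t) / (1 + c * t) := by
  rcases hc.eq_or_lt with rfl | hc'
  · have : ∫ t in (0:ℝ)..1, (1 - t) / (1 + 0 * t) = 1 / 2 := by
      simp only [zero_mul, add_zero, div_one]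
      rw [intervalIntegral.integral_sub (by simp) (by simp)]
      simp
      norm_num
    rw [this]
    simp [shearerF]
  · have key : ∫ t in (0:ℝ)..1, (1 - t) / (1 + c * t)
        = (fun t => -t / c + (c + 1) / c ^ 2 * Real.log (1 + c * t)) 1
          - (fun t => -t / c + (c + 1) / c ^ 2 * Real.log (1 + c * t)) 0 := by
      refine intervalIntegral.integral_eq_sub_of_hasDerivAt (f := fun t => -t / c + (c + 1) / c ^ 2 * Real.log (1 + c * t)) ?_ (integ c hc)
      intro t ht
      rw [Set.uIcc_of_le zero_le_one] at ht
      have hp := h_pos c t hc ht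
      have h1 : HasDerivAt (fun t : ℝ => 1 + c * t) c t := by
        simpa using ((hasDerivAt_id t).const_mul c).const_add 1
      have h2 := (h1.log hp.ne').const_mul ((c + 1) / c ^ 2)
      have h3 := ((hasDerivAt_id t).neg.div_const c).add h2
      have e : (1 - t) / (1 + c * t) = -1 / c + (c + 1) / c ^ 2 * (c / (1 + c * t)) := by
        have hp' := hp.ne'
        generalize hx : 1 + c * t = x at *
        field_simp
        subst hx
        ring
      rw [e]
      exact h3
    rw [key]
    have e1 : ¬ (c + 1 ≤ 0) := by linarith
    have e2 : ¬ (c + 1 = 1) := by intro h; linarith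
    simp only [shearerF, if_neg e1, if_neg e2]
    have e3 : c + 1 - 1 = c := by ring
    rw [e3]
    simp
    rw [add_comm 1 c]
    field_simp

lemma F_zero : shearerF 0 = 1 := by simp [shearerF]

lemma F_one : shearerF 1 = 1 / 2 := by simp [shearerF]

lemma F_two : 0 ≤ shearerF 2 := by
  have : shearerF 2 = (1 - 2) + 2 * Real.log 2 := by
    norm_num [shearerF]
  rw [this]
  have := Real.log_two_gt_d9
  linarith

lemma F_convex (n : ℕ) : 2 * shearerF ((n + 1 : ℕ) : ℝ) ≤ shearerF (n : ℝ) + shearerF ((n + 2 : ℕ) : ℝ) := by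
  rcases n with _ | m
  · have := F_two
    norm_num [F_zero, F_one]
    linarith
  · have hm : (0:ℝ) ≤ m := Nat.cast_nonneg m
    have a0 : ((m + 1 : ℕ) : ℝ) = (m : ℝ) + 1 := by push_cast; ring
    have a1 : ((m + 1 + 1 : ℕ) : ℝ) = ((m : ℝ) + 1) + 1 := by push_cast; ring
    have a2 : ((m + 1 + 2 : ℕ) : ℝ) = ((m : ℝ) + 2) + 1 := by push_cast; ring
    rw [a0, a1, a2, F_eq _ hm, F_eq _ (by linarith), F_eq _ (by linarith),
      ← intervalIntegral.integral_add (integ _ hm) (integ _ (by linarith)),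
      ← intervalIntegral.integral_const_mul]
    apply intervalIntegral.integral_mono_on zero_le_one
    · exact (integ _ (by linarith)).const_mul _
    · exact (integ _ hm).add (integ _ (by linarith))
    · intro t ht
      have p0 := h_pos m t hm ht
      have p1 := h_pos (m+1) t (by linarith) ht
      have p2 := h_pos (m+2) t (by linarith) ht
      have ht1 : 0 ≤ 1 - t := by linarith [ht.2]
      rw [← sub_nonneg]
      have : (1 - t) / (1 + (m:ℝ) * t) + (1 - t) / (1 + ((m:ℝ) + 2) * t) - 2 * ((1 - t) / (1 + ((m:ℝ) + 1) * t))
        = (1 - t) * (2 * t ^ 2) / ((1 + (m:ℝ) * t) * (1 + ((m:ℝ) + 1) * t) * (1 + ((m:ℝ) + 2) * t)) := by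
        have q0 := p0.ne'
        have q1 := p1.ne'
        have q2 := p2.ne'
        clear p0 p1 p2
        generalize hx : 1 + (m:ℝ) * t = x at *
        generalize hy : 1 + ((m:ℝ) + 1) * t = y at *
        generalize hz : 1 + ((m:ℝ) + 2) * t = z at *
        field_simp
        subst hx hy hz
        ring
      rw [this]
      positivity

lemma F_rec (n : ℕ) :
    (((n:ℝ)) ^ 2 + 1) * shearerF (n : ℝ) ≤ 1 + ((n:ℝ) ^ 2 - n) * shearerF ((n - 1 : ℕ) : ℝ) := by
  rcases n with _ | _ | m
  · simp [F_zero]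
  · norm_num [F_one]
  · have hm : (0:ℝ) ≤ m := Nat.cast_nonneg m
    have a0 : ((m + 1 + 1 - 1 : ℕ) : ℝ) = (m : ℝ) + 1 := by push_cast [Nat.add_sub_cancel]; ring
    have a1 : ((m + 1 + 1 : ℕ) : ℝ) = ((m : ℝ) + 1) + 1 := by push_cast; ring
    rw [a0, a1, F_eq _ hm, F_eq _ (by linarith)]
    have hone : ∫ t in (0:ℝ)..1, ((m:ℝ) + 3 - 2 * t - (m + 1) * t ^ 2) / (1 + ((m:ℝ) + 1) * t) ^ 2 = 1 := by
      have hc : ContinuousOn (fun t : ℝ => ((m:ℝ) + 3 - 2 * t - (m + 1) * t ^ 2) / (1 + ((m:ℝ) + 1) * t) ^ 2)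
          (Set.uIcc 0 1) := by
        rw [Set.uIcc_of_le zero_le_one]
        apply ContinuousOn.div (by fun_prop) (by fun_prop)
        intro t ht
        exact (pow_pos (h_pos (m+1) t (by linarith) ht) 2).ne'
      rw [intervalIntegral.integral_eq_sub_of_hasDerivAt
        (f := fun t => (((m:ℝ) + 3) * t - t ^ 2) / (1 + ((m:ℝ) + 1) * t)) _ hc.intervalIntegrable]
      · have : (1 + ((m:ℝ) + 1) * 1) ≠ 0 := by positivity
        field_simp
        ring
      · intro t ht
        rw [Set.uIcc_of_le zero_le_one] at ht
        have hp := h_pos (m+1) t (by linarith) ht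
        have h1 : HasDerivAt (fun t : ℝ => 1 + ((m:ℝ) + 1) * t) ((m:ℝ) + 1) t := by
          simpa using ((hasDerivAt_id t).const_mul ((m:ℝ) + 1)).const_add 1
        have h2 : HasDerivAt (fun t : ℝ => ((m:ℝ) + 3) * t - t ^ 2) (((m:ℝ) + 3) - 2 * t) t := by
          have h3 := ((hasDerivAt_id t).const_mul ((m:ℝ) + 3)).sub (hasDerivAt_pow 2 t)
          simp only [mul_one, Nat.cast_ofNat, Nat.add_one_sub_one, pow_one] at h3
          exact h3
        have h4 := h2.div h1 hp.ne'
        have e : (((m:ℝ) + 3) - 2 * t) * (1 + ((m:ℝ) + 1) * t) - (((m:ℝ) + 3) * t - t ^ 2) * ((m:ℝ) + 1)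
            = (m:ℝ) + 3 - 2 * t - (m + 1) * t ^ 2 := by ring
        rw [e] at h4
        exact h4
    have hI : IntervalIntegrable (fun t : ℝ => ((m:ℝ) + 3 - 2 * t - (m + 1) * t ^ 2) / (1 + ((m:ℝ) + 1) * t) ^ 2)
        MeasureTheory.volume 0 1 := by
      apply ContinuousOn.intervalIntegrable
      rw [Set.uIcc_of_le zero_le_one]
      apply ContinuousOn.div (by fun_prop) (by fun_prop)
      intro t ht
      exact (pow_pos (h_pos (m+1) t (by linarith) ht) 2).ne'
    refine le_of_le_of_eq ?_ (congrArg (· + _) hone)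
    rw [← intervalIntegral.integral_const_mul, ← intervalIntegral.integral_const_mul]
    beta_reduce
    rw [← intervalIntegral.integral_add hI ((integ _ hm).const_mul _)]
    apply intervalIntegral.integral_mono_on zero_le_one
    · exact (integ _ (by linarith)).const_mul _
    · exact hI.add ((integ _ hm).const_mul _)
    · intro t ht
      have p0 := h_pos m t hm ht
      have p1 := h_pos (m+1) t (by linarith) ht
      have ht1 : 0 ≤ 1 - t := by linarith [ht.2]
      rw [← sub_nonneg]
      have : ((m:ℝ) + 3 - 2 * t - (m + 1) * t ^ 2) / (1 + ((m:ℝ) + 1) * t) ^ 2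
          + (((m:ℝ) + 1 + 1) ^ 2 - ((m:ℝ) + 1 + 1)) * ((1 - t) / (1 + (m:ℝ) * t))
          - (((m:ℝ) + 1 + 1) ^ 2 + 1) * ((1 - t) / (1 + ((m:ℝ) + 1) * t))
          = (1 - t) * (((m:ℝ) + 1) * (m + 2) * t ^ 2) / ((1 + (m:ℝ) * t) * (1 + ((m:ℝ) + 1) * t) ^ 2) := by
        have q0 := p0.ne'
        have q1 := p1.ne'
        clear p0 p1
        generalize hx : 1 + (m:ℝ) * t = x at *
        generalize hy : 1 + ((m:ℝ) + 1) * t = y at *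
        field_simp
        subst hx hy
        ring
      rw [this]
      positivity

/-- Discrete slope. -/
noncomputable def g (n : ℕ) : ℝ := shearerF ((n - 1 : ℕ) : ℝ) - shearerF (n : ℝ)

lemma g_anti {a b : ℕ} (ha : 1 ≤ a) (hab : a ≤ b) : g b ≤ g a := by
  induction b, hab using Nat.le_induction with
  | base => exact le_rfl
  | succ k hk ih =>
    refine le_trans ?_ ih
    obtain ⟨j, rfl⟩ : ∃ j, k = j + 1 := ⟨k - 1, by omega⟩
    have := F_convex j
    simp only [g, Nat.add_sub_cancel]
    linarith

lemma F_drop (d t : ℕ) (h : t ≤ d) :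
    (t : ℝ) * g d ≤ shearerF ((d - t : ℕ) : ℝ) - shearerF (d : ℝ) := by
  induction t with
  | zero => simp
  | succ k ih =>
    have h1 := ih (by omega)
    have h2 := g_anti (a := d - k) (b := d) (by omega) (by omega)
    have h3 : g (d - k) = shearerF ((d - (k + 1) : ℕ) : ℝ) - shearerF ((d - k : ℕ) : ℝ) := by
      simp only [g, Nat.sub_sub]
    push_cast
    linarith

set_option linter.unusedSectionVars false

variable {V : Type*} [DecidableEq V] (G : SimpleGraph V) [DecidableRel G.Adj]

/-- Degree inside `S`. -/
def deg (S : Finset V) (v : V) : ℕ := #{u ∈ S | G.Adj v u}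

/-- Adjacency indicator. -/
def A (v u : V) : ℝ := if G.Adj v u then 1 else 0

lemma A_symm (v u : V) : A G v u = A G u v := by simp [A, G.adj_comm]

lemma deg_eq (S : Finset V) (v : V) : (deg G S v : ℝ) = ∑ u ∈ S, A G v u := by
  simp [deg, A]

/-- Common neighbours inside `S`. -/
def com (S : Finset V) (v w : V) : ℕ := #{u ∈ S | G.Adj w u ∧ G.Adj v u}

lemma com_eq (S : Finset V) (v w : V) : (com G S v w : ℝ) = ∑ u ∈ S, A G w u * A G v u := by
  simp [com, A, ← ite_and, and_comm]

/-- Remaining vertices after deletion of the closed neighbourhood of `v`. -/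
def rest (S : Finset V) (v : V) : Finset V := {w ∈ S | ¬ (w = v ∨ G.Adj v w)}

lemma com_le (S : Finset V) (v w : V) : com G S v w ≤ deg G S w := by
  apply card_le_card
  intro u
  simp only [mem_filter]
  tauto

lemma deg_rest (S : Finset V) (v w : V) (h : ¬ G.Adj v w) :
    deg G (rest G S v) w = deg G S w - com G S v w := by
  have : deg G (rest G S v) w + com G S v w = deg G S w := by
    unfold deg com rest
    rw [← card_union_of_disjoint]
    · congr 1
      ext u
      simp only [mem_union, mem_filter]
      constructor
      · tauto
      · rintro ⟨hu, hw⟩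
        have : u ≠ v := by rintro rfl; exact h hw.symm
        tauto
    · rw [Finset.disjoint_left]
      intro u
      simp only [mem_filter]
      tauto
  omega

lemma com_adj (hG : G.CliqueFree 3) (S : Finset V) (v w : V) (h : G.Adj v w) : com G S v w = 0 := by
  unfold com
  rw [card_eq_zero, filter_eq_empty_iff]
  rintro u - ⟨h1, h2⟩
  exact hG {v, w, u} (SimpleGraph.is3Clique_triple_iff.2 ⟨h, h2, h1⟩)

lemma com_self (S : Finset V) (v : V) : com G S v v = deg G S v := by
  simp [com, deg]

lemma loss (hG : G.CliqueFree 3) (S : Finset V) (v w : V) :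
    (com G S v w : ℝ) * g (deg G S w)
      - (if w = v then shearerF (deg G S w) + deg G S w * g (deg G S w) else 0)
      - A G w v * shearerF (deg G S w) ≤
    (if ¬ (w = v ∨ G.Adj v w) then shearerF (deg G (rest G S v) w) else 0)
      - shearerF (deg G S w) := by
  by_cases h1 : w = v
  · subst h1
    simp [A, com_self]
  · by_cases h2 : G.Adj v w
    · simp [A, com_adj G hG S v w h2, h1, h2, h2.symm]
    · have h3 : ¬ G.Adj w v := fun h => h2 h.symm
      have := F_drop _ _ (com_le G S v w)
      simp only [A, h1, h2, h3, if_false, or_self, not_false_eq_true, if_true,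
        deg_rest G S v w h2]
      linarith

lemma edge_sum (S : Finset V) :
    0 ≤ ∑ w ∈ S, ∑ u ∈ S, A G w u * (((deg G S u : ℝ) - deg G S w) * g (deg G S w)) := by
  set X := ∑ w ∈ S, ∑ u ∈ S, A G w u * (((deg G S u : ℝ) - deg G S w) * g (deg G S w)) with hX
  have h2 : X = ∑ w ∈ S, ∑ u ∈ S, A G w u * (((deg G S w : ℝ) - deg G S u) * g (deg G S u)) := by
    rw [hX, sum_comm]
    refine sum_congr rfl fun w _ => sum_congr rfl fun u _ => ?_
    rw [A_symm]
  have h3 : 0 ≤ X + X := by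
    nth_rw 2 [h2]
    rw [hX, ← sum_add_distrib]
    refine sum_nonneg fun w hw => ?_
    rw [← sum_add_distrib]
    refine sum_nonneg fun u hu => ?_
    unfold A
    split_ifs with h
    · have pw : 1 ≤ deg G S w := card_pos.2 ⟨u, by simp [hu, h]⟩
      have pu : 1 ≤ deg G S u := card_pos.2 ⟨w, by simp [hw, h.symm]⟩
      rcases le_total (deg G S w) (deg G S u) with hl | hl
      · have := g_anti pw hl
        have hl' : (deg G S w : ℝ) ≤ deg G S u := by exact_mod_cast hl
        nlinarith
      · have := g_anti pu hl
        have hl' : (deg G S u : ℝ) ≤ deg G S w := by exact_mod_cast hl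
        nlinarith
    · simp
  linarith

lemma total (hG : G.CliqueFree 3) (S : Finset V) :
    0 ≤ ∑ v ∈ S, (1 + ∑ w ∈ rest G S v, shearerF (deg G (rest G S v) w)
      - ∑ w ∈ S, shearerF (deg G S w)) := by
  have h1 : ∀ v ∈ S, 1 + ∑ w ∈ S, ((com G S v w : ℝ) * g (deg G S w)
      - (if w = v then shearerF (deg G S w) + deg G S w * g (deg G S w) else 0)
      - A G w v * shearerF (deg G S w)) ≤
      1 + ∑ w ∈ rest G S v, shearerF (deg G (rest G S v) w)
      - ∑ w ∈ S, shearerF (deg G S w) := by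
    intro v _
    have := sum_le_sum fun w (_ : w ∈ S) => loss G hG S v w
    rw [sum_sub_distrib (s := S) (f := fun w => if ¬ (w = v ∨ G.Adj v w) then shearerF (deg G (rest G S v) w) else 0),
      ← sum_filter] at this
    change _ ≤ ∑ w ∈ rest G S v, shearerF (deg G (rest G S v) w) - _ at this
    linarith
  refine le_trans ?_ (sum_le_sum h1)
  rw [sum_add_distrib, sum_comm, ← sum_add_distrib]
  have h2 : ∀ w ∈ S, ∑ u ∈ S, A G w u * (((deg G S u : ℝ) - deg G S w) * g (deg G S w)) ≤
      1 + ∑ v ∈ S, ((com G S v w : ℝ) * g (deg G S w)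
      - (if w = v then shearerF (deg G S w) + deg G S w * g (deg G S w) else 0)
      - A G w v * shearerF (deg G S w)) := by
    intro w hw
    rw [sum_sub_distrib, sum_sub_distrib, sum_ite_eq, if_pos hw, ← sum_mul, ← sum_mul, ← deg_eq]
    have hc : ∑ v ∈ S, (com G S v w : ℝ) = ∑ u ∈ S, A G w u * deg G S u := by
      simp only [com_eq, deg_eq, mul_sum]
      rw [sum_comm]
      refine sum_congr rfl fun u _ => sum_congr rfl fun v _ => ?_
      rw [A_symm G v u]
    have hl : ∑ u ∈ S, A G w u * (((deg G S u : ℝ) - deg G S w) * g (deg G S w))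
        = (∑ u ∈ S, A G w u * deg G S u) * g (deg G S w)
          - deg G S w * (deg G S w * g (deg G S w)) := by
      conv_rhs => rw [deg_eq G S w, sum_mul, sum_mul, ← sum_sub_distrib]
      rw [← deg_eq]
      refine sum_congr rfl fun u _ => ?_
      ring
    rw [hc, hl]
    have := F_rec (deg G S w)
    unfold g
    nlinarith
  exact le_trans (edge_sum G S) (sum_le_sum h2)

lemma main (hG : G.CliqueFree 3) (n : ℕ) : ∀ S : Finset V, #S ≤ n →
    ∃ I ⊆ S, IsIndepFinset G I ∧ ∑ v ∈ S, shearerF (deg G S v) ≤ (#I : ℝ) := by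
  induction n with
  | zero =>
    intro S hS
    have : S = ∅ := by simpa using hS
    subst this
    exact ⟨∅, by simp, by simp [IsIndepFinset], by simp⟩
  | succ n ih =>
    intro S hS
    rcases S.eq_empty_or_nonempty with rfl | hne
    · exact ⟨∅, by simp, by simp [IsIndepFinset], by simp⟩
    obtain ⟨v, hv, h0⟩ := exists_le_of_sum_le (f := fun _ => (0:ℝ))
      (g := fun v => 1 + ∑ w ∈ rest G S v, shearerF (deg G (rest G S v) w)
        - ∑ w ∈ S, shearerF (deg G S w)) hne
      (by rw [sum_const_zero]; exact total G hG S)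
    have hss : rest G S v ⊂ S := by
      refine ⟨filter_subset _ _, fun h => ?_⟩
      have := h hv
      simp [rest] at this
    obtain ⟨I, hI, hind, hle⟩ := ih (rest G S v) (by have := card_lt_card hss; omega)
    have hprop : ∀ u ∈ I, u ≠ v ∧ ¬ G.Adj v u := by
      intro u hu
      have := hI hu
      simp only [rest, mem_filter] at this
      tauto
    have hvI : v ∉ I := fun h => (hprop v h).1 rfl
    refine ⟨insert v I, ?_, ?_, ?_⟩
    · intro u hu
      rcases mem_insert.1 hu with rfl | hu
      · exact hv
      · exact hss.1 (hI hu)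
    · intro a ha b hb hab
      rcases mem_insert.1 ha with rfl | ha
      · rcases mem_insert.1 hb with rfl | hb
        · exact G.irrefl hab
        · exact (hprop b hb).2 hab
      · rcases mem_insert.1 hb with hb | hb
        · rw [hb] at hab
          exact (hprop a ha).2 hab.symm
        · exact hind a ha b hb hab
    · rw [card_insert_of_notMem hvI]
      push_cast
      linarith

end ShearerAux

/-- Shearer's degree-sequence bound: every finite triangle-free graph
contains an independent set of size at least `∑_{v} f(d_G(v))`. -/
theorem shearer_degree_sequence_bound {V : Type*} [Fintype V] [DecidableEq V]
    (G : SimpleGraph V) [DecidableRel G.Adj] (hG : G.CliqueFree 3) :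
    ∃ I : Finset V, IsIndepFinset G I ∧
      (∑ v : V, shearerF (G.degree v)) ≤ (I.card : ℝ) := by
  obtain ⟨I, -, h1, h2⟩ := ShearerAux.main G hG _ univ le_rfl
  refine ⟨I, h1, le_trans (le_of_eq ?_) h2⟩
  refine sum_congr rfl fun v _ => ?_
  rw [ShearerAux.deg, ← SimpleGraph.card_neighborFinset_eq_degree, SimpleGraph.neighborFinset_eq_filter]
end

section
/- Every finite triangle-free simple graph G with maximum degree Δ admits a probability distribution p on its independent sets under which every vertex of G is covered with probability at least f(Δ); in particular, the fractional chromatic number of G is at most 1/f(Δ) = (1 + o(1))·Δ/ln Δ as Δ → ∞. -/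
open Finset

/-- denominators are positive -/
lemma den_pos {x t : ℝ} (hx : 0 < x) (h0 : 0 ≤ t) (h1 : t ≤ 1) : 0 < 1 + (x - 1) * t := by
  rcases eq_or_lt_of_le h1 with rfl | h
  · linarith
  · nlinarith [mul_nonneg hx.le h0]

/-- the antiderivative computation of the Shearer function -/
lemma integral_eq_shearer {x : ℝ} (hx : 0 < x) :
    ∫ t in (0:ℝ)..1, (1 - t) / (1 + (x - 1) * t) = shearerF x := by
  unfold shearerF
  rw [if_neg (not_le.mpr hx)]
  split_ifs with h1
  · subst h1
    simp only [sub_self, zero_mul, add_zero, div_one]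
    rw [intervalIntegral.integral_sub (by simp) (by simp)]
    simp
    norm_num
  · have ha : x - 1 ≠ 0 := sub_ne_zero.mpr h1
    have key := intervalIntegral.integral_eq_sub_of_hasDerivAt (a := 0) (b := 1)
      (f := fun t => -t / (x-1) + x / (x-1)^2 * Real.log (1 + (x-1) * t))
      (f' := fun t => (1 - t) / (1 + (x - 1) * t)) ?_ ?_
    · rw [key]
      have : 1 + (x - 1) * 1 = x := by ring
      simp only [this]
      simp
      field_simp
      ring
    · intro t ht
      rw [Set.uIcc_of_le zero_le_one] at ht
      have hd := den_pos hx ht.1 ht.2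
      have h2 : HasDerivAt (fun t : ℝ => 1 + (x-1) * t) (x-1) t := by
        simpa using ((hasDerivAt_id t).const_mul (x-1)).const_add 1
      have h3 := (h2.log hd.ne').const_mul (x / (x-1)^2)
      have h4 := ((hasDerivAt_id t).neg.div_const (x-1)).add h3
      refine h4.congr_deriv ?_
      field_simp
      ring
    · apply ContinuousOn.intervalIntegrable
      rw [Set.uIcc_of_le zero_le_one]
      apply ContinuousOn.div (by fun_prop) (by fun_prop)
      intro t ht
      exact (den_pos hx ht.1 ht.2).ne'

lemma int1 {x : ℝ} (hx : 0 < x) :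
    IntervalIntegrable (fun t : ℝ => (1 - t) / (1 + (x - 1) * t)) MeasureTheory.volume 0 1 := by
  apply ContinuousOn.intervalIntegrable
  rw [Set.uIcc_of_le zero_le_one]
  apply ContinuousOn.div (by fun_prop) (by fun_prop)
  intro t ht
  exact (den_pos hx ht.1 ht.2).ne'

lemma int2 {x : ℝ} (hx : 0 < x) :
    IntervalIntegrable (fun t : ℝ => t * (1 - t) / (1 + (x - 1) * t) ^ 2)
      MeasureTheory.volume 0 1 := by
  apply ContinuousOn.intervalIntegrable
  rw [Set.uIcc_of_le zero_le_one]
  apply ContinuousOn.div (by fun_prop) (by fun_prop)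
  intro t ht
  exact (pow_pos (den_pos hx ht.1 ht.2) 2).ne'

lemma shearerF_zero : shearerF 0 = 1 := by simp [shearerF]

lemma shearerF_nonneg {x : ℝ} : 0 ≤ shearerF x := by
  rcases le_or_gt x 0 with hx | hx
  · simp [shearerF, hx]
  rw [← integral_eq_shearer hx]
  apply intervalIntegral.integral_nonneg zero_le_one
  intro t ht
  exact div_nonneg (by linarith [ht.2]) (den_pos hx ht.1 ht.2).le

/-- tangent line bound, with the Shearer differential equation for the slope -/
lemma tangent {r : ℝ} (hr : 0 < r) : ∃ g : ℝ, 0 ≤ g ∧ g * r ≤ 1 ∧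
    1 - (1 + r) * shearerF r + g * (r * (r - 1)) = 0 ∧
    ∀ y, 0 ≤ y → shearerF r - g * (y - r) ≤ shearerF y := by
  set g : ℝ := ∫ t in (0:ℝ)..1, t * (1 - t) / (1 + (r - 1) * t) ^ 2 with hg
  have hg0 : 0 ≤ g := by
    apply intervalIntegral.integral_nonneg zero_le_one
    intro t ht
    exact div_nonneg (mul_nonneg ht.1 (by linarith [ht.2])) (by positivity)
  have htan : ∀ y, 0 ≤ y → shearerF r - g * (y - r) ≤ shearerF y := by
    intro y hy
    have e1 : shearerF r - g * (y - r) = ∫ t in (0:ℝ)..1, ((1 - t) / (1 + (r - 1) * t)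
        - t * (1 - t) / (1 + (r - 1) * t) ^ 2 * (y - r)) := by
      rw [intervalIntegral.integral_sub (int1 hr) ((int2 hr).mul_const _),
        intervalIntegral.integral_mul_const, integral_eq_shearer hr]
    rw [e1]
    have hi := (int1 hr).sub ((int2 hr).mul_const (y - r))
    rcases eq_or_lt_of_le hy with rfl | hy
    · rw [shearerF_zero]
      have : (1:ℝ) = ∫ t in (0:ℝ)..1, (1:ℝ) := by simp
      conv_rhs => rw [this]
      apply intervalIntegral.integral_mono_on zero_le_one hi (by simp)
      intro t ht
      have hd := den_pos hr ht.1 ht.2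
      have h1 : 0 ≤ 1 - t := by linarith [ht.2]
      have : (1 - t) / (1 + (r - 1) * t) - t * (1 - t) / (1 + (r - 1) * t) ^ 2 * (0 - r)
        = ((1-t) * (1 + (r - 1) * t) + r * t * (1-t)) / (1 + (r - 1) * t)^2 := by
        field_simp; ring
      rw [this, div_le_one (by positivity)]
      nlinarith [mul_nonneg (mul_nonneg hr.le ht.1) (mul_nonneg hr.le ht.1)]
    · rw [← integral_eq_shearer hy]
      apply intervalIntegral.integral_mono_on zero_le_one hi (int1 hy)
      intro t ht
      have hd := den_pos hr ht.1 ht.2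
      have hd' := den_pos hy ht.1 ht.2
      have h1 : 0 ≤ 1 - t := by linarith [ht.2]
      rw [← sub_nonneg]
      have : (1 - t) / (1 + (y - 1) * t) - ((1 - t) / (1 + (r - 1) * t)
        - t * (1 - t) / (1 + (r - 1) * t) ^ 2 * (y - r))
        = (1-t) * (t * (y - r))^2 / ((1 + (r - 1) * t)^2 * (1 + (y - 1) * t)) := by
        generalize hD : 1 + (r - 1) * t = D at *
        generalize hE : 1 + (y - 1) * t = E at *
        field_simp
        subst hD hE
        ring
      rw [this]
      positivity
  refine ⟨g, hg0, ?_, ?_, htan⟩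
  · have := htan 0 le_rfl
    rw [shearerF_zero] at this
    have := shearerF_nonneg (x := r)
    linarith
  · have e1 : 1 - (1 + r) * shearerF r + g * (r * (r - 1)) =
       ∫ t in (0:ℝ)..1, (1 - (1 + r) * ((1 - t) / (1 + (r - 1) * t))
        + t * (1 - t) / (1 + (r - 1) * t) ^ 2 * (r * (r - 1))) := by
      rw [intervalIntegral.integral_add ((by simp : IntervalIntegrable (fun _ => (1:ℝ)) MeasureTheory.volume 0 1).sub ((int1 hr).const_mul _)) ((int2 hr).mul_const _),
        intervalIntegral.integral_sub (by simp) ((int1 hr).const_mul _),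
        intervalIntegral.integral_mul_const, intervalIntegral.integral_const_mul,
        integral_eq_shearer hr]
      simp [hg]
    rw [e1, intervalIntegral.integral_eq_sub_of_hasDerivAt
      (f := fun t => -r * (t * (1 - t) / (1 + (r - 1) * t)))]
    · simp
    · intro t ht
      rw [Set.uIcc_of_le zero_le_one] at ht
      have hd := den_pos hr ht.1 ht.2
      have h2 : HasDerivAt (fun t : ℝ => 1 + (r-1) * t) (r-1) t := by
        simpa using ((hasDerivAt_id t).const_mul (r-1)).const_add 1
      have h3 : HasDerivAt (fun t : ℝ => t * (1 - t)) (1 * (1 - t) + t * (-1)) t :=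
        (hasDerivAt_id t).mul ((hasDerivAt_id t).const_sub 1)
      refine ((h3.div h2 hd.ne').const_mul (-r)).congr_deriv ?_
      generalize hD : 1 + (r - 1) * t = D at *
      field_simp
      subst hD
      ring
    · exact ((by simp : IntervalIntegrable (fun _ => (1:ℝ)) MeasureTheory.volume 0 1).sub ((int1 hr).const_mul _)).add ((int2 hr).mul_const _)

lemma shearerF_anti {y r : ℝ} (hy : 0 ≤ y) (h : y ≤ r) : shearerF r ≤ shearerF y := by
  rcases eq_or_lt_of_le (hy.trans h) with h0 | hr
  · rw [show y = r by linarith]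
  · obtain ⟨g, hg, -, -, ht⟩ := tangent hr
    nlinarith [ht y hy, mul_nonneg hg (sub_nonneg.mpr h)]

/-- unified tangent bound including the degenerate point `0` -/
lemma tangent0 {r : ℝ} (hr : 0 ≤ r) : ∃ g : ℝ, 0 ≤ g ∧ g * r ≤ 1 ∧
    1 - (1 + r) * shearerF r + g * (r * (r - 1)) = 0 ∧
    ∀ y, 0 ≤ y → (r = 0 → y = 0) → shearerF r - g * (y - r) ≤ shearerF y := by
  rcases eq_or_lt_of_le hr with h | h
  · subst h
    refine ⟨0, le_rfl, by simp, by simp [shearerF_zero], ?_⟩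
    intro y _ h
    simp [h rfl]
  · obtain ⟨g, h0, h1, h2, h3⟩ := tangent h
    exact ⟨g, h0, h1, h2, fun y hy _ => h3 y hy⟩

/-- the algebraic heart of one step -/
lemma core {w S Q r f g fp B ε δ : ℝ} (hw : 0 < w) (hS : 0 ≤ S) (hS1 : S ≤ 1) (hQ : 0 ≤ Q)
    (hr : r = S / w) (hg : 0 ≤ g) (hgr : g * r ≤ 1)
    (hode : 1 - (1 + r) * f + g * (r * (r - 1)) = 0)
    (he : 0 < ε) (he1 : ε ≤ 1)
    (hfp : f - g * ((S + ε * Q) / (w * (1 + ε * S)) - r) ≤ fp)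
    (hB : f + g * (Q / w) - w * (f + g * (S / w) - 1) - S * f ≤ B) :
    f - ((1 - ε) * δ + 2 * ε ^ 2) ≤ (1 - ε) * (fp - δ) + ε * B := by
  have hD : 0 < 1 + ε * S := by positivity
  have hSr : S = r * w := by rw [hr]; field_simp
  set κ := (1 - ε) / (1 + ε * S) with hκ
  set q := Q / w with hq
  have hq0 : 0 ≤ q := by positivity
  have hr0 : 0 ≤ r := by rw [hr]; positivity
  have hZ : (1 - ε) * ((S + ε * Q) / (w * (1 + ε * S)) - r) = κ * ε * (q - r * S) := by
    rw [hκ, hq, hr]; field_simp; ring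
  have hk0 : 0 ≤ 1 - κ := by
    rw [sub_nonneg, hκ, div_le_one hD]; nlinarith
  have hk1 : 1 - κ ≤ 2 * ε := by
    have : 1 - κ = ε * (1 + S) / (1 + ε * S) := by rw [hκ]; field_simp; ring
    rw [this, div_le_iff₀ hD]
    nlinarith [mul_nonneg (mul_nonneg he.le he.le) hS]
  have hgrS : g * r * S ≤ 1 := by
    have := mul_le_mul hgr hS1 hS zero_le_one
    linarith
  have hgrS0 : 0 ≤ g * r * S := by positivity
  have e1 : (1 - κ) * (g * r * S) ≤ 2 * ε := by
    calc (1 - κ) * (g * r * S) ≤ (1 - κ) * 1 := by gcongr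
      _ ≤ _ := by linarith
  have e2 : 0 ≤ (1 - κ) * (g * q) := by positivity
  have h1 : (1 - ε) * (f - g * ((S + ε * Q) / (w * (1 + ε * S)) - r)) ≤ (1 - ε) * fp :=
    mul_le_mul_of_nonneg_left hfp (by linarith)
  have h2 := mul_le_mul_of_nonneg_left hB he.le
  have h3 : (1 - ε) * (f - g * ((S + ε * Q) / (w * (1 + ε * S)) - r))
      = (1 - ε) * f - g * (κ * ε * (q - r * S)) := by rw [← hZ]; ring
  rw [h3] at h1
  have h4 : ε * (f + g * q - w * (f + g * (S / w) - 1) - S * f)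
      = ε * f + ε * g * q - ε * g * r * S
        + ε * w * (1 - (1 + r) * f + g * (r * (r - 1))) := by
    rw [← hr, hSr]; ring
  rw [h4, hode] at h2
  have e3 := mul_le_mul_of_nonneg_left e1 he.le
  have e4 := mul_nonneg he.le e2
  nlinarith

section Graph

variable {V : Type*} [Fintype V] [DecidableEq V]

/-- the indicator vector of a finite set -/
def ind (I : Finset V) : V → ℝ := fun v => if v ∈ I then 1 else 0

/-- the polytope spanned by indicator vectors of independent subsets of `U` -/
def R (G : SimpleGraph V) (U : Finset V) : Set (V → ℝ) :=
  convexHull ℝ {c | ∃ I ⊆ U, IsIndepFinset G I ∧ c = ind I}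

/-- real adjacency matrix -/
def adj (G : SimpleGraph V) [DecidableRel G.Adj] (u v : V) : ℝ := if G.Adj u v then 1 else 0

/-- weighted neighbourhood sum -/
def S (G : SimpleGraph V) [DecidableRel G.Adj] (U : Finset V) (W : V → ℝ) (u : V) : ℝ :=
  ∑ x ∈ U, adj G u x * W x

/-- vertices of `U` outside the closed neighbourhood of `v` -/
def del (G : SimpleGraph V) [DecidableRel G.Adj] (U : Finset V) (v : V) : Finset V :=
  U.filter (fun x => x ≠ v ∧ ¬ G.Adj v x)

lemma R_nonneg {G : SimpleGraph V} {U : Finset V} {c : V → ℝ} (hc : c ∈ R G U) (u : V) :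
    0 ≤ c u := by
  have : R G U ⊆ {c : V → ℝ | 0 ≤ c} := by
    apply convexHull_min
    · rintro _ ⟨I, -, -, rfl⟩ v
      simp only [ind, Pi.zero_apply]
      split_ifs <;> norm_num
    · exact convex_Ici (𝕜 := ℝ) (0 : V → ℝ)
  exact this hc u

lemma R_insert {G : SimpleGraph V} [DecidableRel G.Adj] {U : Finset V} {v : V} (hv : v ∈ U)
    {c : V → ℝ} (hc : c ∈ R G (del G U v)) : c + ind {v} ∈ R G U := by
  have : R G (del G U v) ⊆ {c : V → ℝ | c + ind {v} ∈ R G U} := by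
    apply convexHull_min
    · rintro _ ⟨I, hI, hi, rfl⟩
      apply subset_convexHull
      refine ⟨insert v I, ?_, ?_, ?_⟩
      · intro x hx
        rcases Finset.mem_insert.mp hx with rfl | hx
        · exact hv
        · exact (Finset.mem_filter.mp (hI hx)).1
      · have key : ∀ x ∈ I, ¬ G.Adj v x := fun x hx => (Finset.mem_filter.mp (hI hx)).2.2
        intro a ha b hb
        rcases Finset.mem_insert.mp ha with rfl | ha'
        · rcases Finset.mem_insert.mp hb with rfl | hb
          · exact G.loopless.irrefl _
          · exact key b hb
        · rcases Finset.mem_insert.mp hb with rfl | hb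
          · exact fun h => key a ha' h.symm
          · exact hi a ha' b hb
      · have hvI : v ∉ I := fun h => (Finset.mem_filter.mp (hI h)).2.1 rfl
        funext x
        by_cases hx : x = v
        · subst hx; simp [ind, hvI]
        · simp [ind, hx]
    · have h := (convex_convexHull ℝ {c | ∃ I ⊆ U, IsIndepFinset G I ∧ c = ind I})
      exact h.translate_preimage_left (ind {v})
  exact this hc

lemma adj_nonneg (G : SimpleGraph V) [DecidableRel G.Adj] (u v : V) : 0 ≤ adj G u v := by
  unfold adj; split_ifs <;> norm_num

lemma adj_le (G : SimpleGraph V) [DecidableRel G.Adj] (u v : V) : adj G u v ≤ 1 := by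
  unfold adj; split_ifs <;> norm_num

lemma adj_comm' (G : SimpleGraph V) [DecidableRel G.Adj] (u v : V) : adj G u v = adj G v u := by
  simp [adj, G.adj_comm]

lemma S_nonneg (G : SimpleGraph V) [DecidableRel G.Adj] (U : Finset V) {W : V → ℝ}
    (hW : ∀ x, 0 < W x) (u : V) : 0 ≤ S G U W u :=
  Finset.sum_nonneg fun x _ => mul_nonneg (adj_nonneg G u x) (hW x).le

lemma S_del (G : SimpleGraph V) [DecidableRel G.Adj] (U : Finset V) (W : V → ℝ) {u v : V}
    (huv : ¬ G.Adj u v) :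
    S G (del G U v) W u = S G U W u - ∑ x ∈ U, adj G u x * adj G v x * W x := by
  unfold S del
  rw [Finset.sum_filter, ← Finset.sum_sub_distrib]
  apply Finset.sum_congr rfl
  intro x _
  unfold adj
  by_cases h1 : G.Adj u x
  · have : x ≠ v := by rintro rfl; exact huv h1
    by_cases h2 : G.Adj v x <;> simp [h1, h2, this]
  · simp [h1]

/-- the exact demand statement with an error term -/
def Good (G : SimpleGraph V) [DecidableRel G.Adj] (U : Finset V) (δ : ℝ) : Prop :=
  ∀ W : V → ℝ, (∀ x, 0 < W x) → ∃ c ∈ R G U, ∀ u ∈ U, shearerF (S G U W u / W u) - δ ≤ c u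

lemma step_normalized (G : SimpleGraph V) [DecidableRel G.Adj] (hG : G.CliqueFree 3)
    (U : Finset V) (IH : ∀ U' ⊂ U, Good G U' 0) {δ ε : ℝ} (he : 0 < ε) (he1 : ε ≤ 1)
    (hA : Good G U δ) (W : V → ℝ) (hW : ∀ x, 0 < W x) (hsum : ∑ x ∈ U, W x = 1) :
    ∃ c ∈ R G U, ∀ u ∈ U, shearerF (S G U W u / W u) - ((1 - ε) * δ + 2 * ε ^ 2) ≤ c u := by
  have hSn := S_nonneg G U hW
  obtain ⟨c', hc', hcov'⟩ := hA (fun x => W x * (1 + ε * S G U W x))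
    (fun x => mul_pos (hW x) (by have := hSn x; positivity))
  have hdel : ∀ v ∈ U, del G U v ⊂ U := by
    intro v hv
    refine (Finset.filter_subset _ _).ssubset_of_mem_notMem hv ?_
    simp [del]
  have hex : ∀ v, ∃ c : V → ℝ, v ∈ U → c ∈ R G (del G U v) ∧
      ∀ u ∈ del G U v, shearerF (S G (del G U v) W u / W u) ≤ c u := by
    intro v
    by_cases hv : v ∈ U
    · obtain ⟨c, h1, h2⟩ := IH _ (hdel v hv) W hW
      exact ⟨c, fun _ => ⟨h1, fun u hu => by simpa using h2 u hu⟩⟩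
    · exact ⟨0, fun h => absurd h hv⟩
  choose c hc using hex
  have hR : Convex ℝ (R G U) := convex_convexHull _ _
  refine ⟨(1 - ε) • c' + ε • ∑ v ∈ U, W v • (c v + ind {v}), ?_, ?_⟩
  · apply hR hc' _ (by linarith) he.le (by ring)
    exact hR.sum_mem (fun v _ => (hW v).le) hsum (fun v hv => R_insert hv (hc v hv).1)
  intro u hu
  have hr0 : 0 ≤ S G U W u / W u := div_nonneg (hSn u) (hW u).le
  obtain ⟨g, hg, hgr, hode, htan⟩ := tangent0 hr0
  set f := shearerF (S G U W u / W u) with hf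
  set Q := ∑ x ∈ U, adj G u x * W x * S G U W x with hQdef
  have hQ : 0 ≤ Q := Finset.sum_nonneg fun x _ =>
    mul_nonneg (mul_nonneg (adj_nonneg G u x) (hW x).le) (hSn x)
  have hS1 : S G U W u ≤ 1 := by
    rw [← hsum]
    apply Finset.sum_le_sum
    intro x _
    nlinarith [adj_le G u x, hW x]
  -- vanishing of neighbours when the weighted degree is zero
  have hzero : S G U W u / W u = 0 → ∀ x ∈ U, adj G u x = 0 := by
    intro h x hx
    have h1 : S G U W u = 0 := by
      rcases div_eq_zero_iff.mp h with h | h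
      · exact h
      · exact absurd h (hW u).ne'
    have h2 := (Finset.sum_eq_zero_iff_of_nonneg
      (fun x _ => mul_nonneg (adj_nonneg G u x) (hW x).le)).mp h1 x hx
    rcases mul_eq_zero.mp h2 with h | h
    · exact h
    · exact absurd h (hW x).ne'
  have hSflow : S G U (fun x => W x * (1 + ε * S G U W x)) u = S G U W u + ε * Q := by
    rw [hQdef, Finset.mul_sum]
    unfold S
    rw [← Finset.sum_add_distrib]
    apply Finset.sum_congr rfl
    intro x _
    ring
  have hcov := hcov' u hu
  simp only [hSflow] at hcov
  have hDpos : 0 < W u * (1 + ε * S G U W u) :=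
    mul_pos (hW u) (by have := hSn u; positivity)
  have hfp := htan ((S G U W u + ε * Q) / (W u * (1 + ε * S G U W u)))
    (div_nonneg (add_nonneg (hSn u) (mul_nonneg he.le hQ)) hDpos.le) (by
      intro h
      have h0 := hzero h
      have h1 : S G U W u = 0 := Finset.sum_eq_zero fun x hx => by rw [h0 x hx, zero_mul]
      have h2 : Q = 0 := Finset.sum_eq_zero fun x hx => by rw [h0 x hx]; ring
      rw [h1, h2]; simp)
  -- bound for each choice of first vertex
  have hpt : ∀ v ∈ U, (f + g * ((∑ x ∈ U, adj G u x * adj G v x * W x) / W u))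
      - (if v = u then f + g * (S G U W u / W u) - 1 else 0) - adj G u v * f
      ≤ (c v + ind {v}) u := by
    intro v hv
    have hnn := R_nonneg (hc v hv).1 u
    by_cases hvu : v = u
    · subst hvu
      have e1 : ∑ x ∈ U, adj G v x * adj G v x * W x = S G U W v := by
        apply Finset.sum_congr rfl
        intro x _
        unfold adj; split_ifs <;> simp
      have e2 : adj G v v = 0 := by simp [adj]
      rw [e1, e2]
      simp [ind]
      linarith
    · have hi : ind {v} u = 0 := by simp [ind, Ne.symm hvu]
      simp only [hvu, if_false, Pi.add_apply, hi]
      by_cases ha : G.Adj u v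
      · have e1 : ∑ x ∈ U, adj G u x * adj G v x * W x = 0 := by
          apply Finset.sum_eq_zero
          intro x _
          by_cases h1 : G.Adj u x
          · by_cases h2 : G.Adj v x
            · exfalso
              exact hG {u, v, x} (SimpleGraph.is3Clique_triple_iff.mpr ⟨ha, h1, h2⟩)
            · simp [adj, h2]
          · simp [adj, h1]
        have e2 : adj G u v = 1 := by simp [adj, ha]
        rw [e1, e2]
        simp
        linarith
      · have e2 : adj G u v = 0 := by simp [adj, ha]
        have hmem : u ∈ del G U v := by
          exact Finset.mem_filter.mpr ⟨hu, Ne.symm hvu, fun h => ha h.symm⟩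
        have h1 := (hc v hv).2 u hmem
        rw [S_del G U W ha] at h1
        have h2 := htan ((S G U W u - ∑ x ∈ U, adj G u x * adj G v x * W x) / W u) (by
            rw [← S_del G U W ha]
            exact div_nonneg (S_nonneg G _ hW u) (hW u).le) (by
            intro h
            have h0 := hzero h
            have h3 : S G U W u = 0 := Finset.sum_eq_zero fun x hx => by rw [h0 x hx, zero_mul]
            have h4 : ∑ x ∈ U, adj G u x * adj G v x * W x = 0 :=
              Finset.sum_eq_zero fun x hx => by rw [h0 x hx]; ring
            simp [h3, h4])
        have h3 := h2.trans h1
        rw [e2]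
        rw [sub_div] at h3
        linarith
  have hB : f + g * (Q / W u) - W u * (f + g * (S G U W u / W u) - 1) - S G U W u * f
      ≤ (∑ v ∈ U, W v • (c v + ind {v})) u := by
    rw [Finset.sum_apply]
    have h1 : ∑ v ∈ U, W v * ((f + g * ((∑ x ∈ U, adj G u x * adj G v x * W x) / W u))
      - (if v = u then f + g * (S G U W u / W u) - 1 else 0) - adj G u v * f)
      ≤ ∑ v ∈ U, (W v • (c v + ind {v})) u := by
      apply Finset.sum_le_sum
      intro v hv
      exact mul_le_mul_of_nonneg_left (hpt v hv) (hW v).le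
    refine le_trans (le_of_eq ?_) h1
    have hQ2 : ∑ v ∈ U, W v * (∑ x ∈ U, adj G u x * adj G v x * W x) = Q := by
      simp only [hQdef, S, Finset.mul_sum]
      rw [Finset.sum_comm]
      apply Finset.sum_congr rfl
      intro x _
      apply Finset.sum_congr rfl
      intro v _
      rw [adj_comm' G v x]
      ring
    have e1 : ∑ v ∈ U, W v * ((f + g * ((∑ x ∈ U, adj G u x * adj G v x * W x) / W u))
      - (if v = u then f + g * (S G U W u / W u) - 1 else 0) - adj G u v * f)
      = (∑ v ∈ U, W v) * f
        + g / W u * (∑ v ∈ U, W v * (∑ x ∈ U, adj G u x * adj G v x * W x))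
        - (∑ v ∈ U, if v = u then W v * (f + g * (S G U W u / W u) - 1) else 0)
        - (∑ v ∈ U, adj G u v * W v) * f := by
      rw [Finset.sum_mul, Finset.sum_mul, Finset.mul_sum, ← Finset.sum_add_distrib,
        ← Finset.sum_sub_distrib, ← Finset.sum_sub_distrib]
      apply Finset.sum_congr rfl
      intro v _
      split_ifs <;> ring
    rw [e1, hQ2, hsum, Finset.sum_ite_eq' U u, if_pos hu]
    unfold S
    ring
  have := core (δ := δ) (hW u) (hSn u) hS1 hQ rfl hg hgr hode he he1 hfp hB
  refine this.trans ?_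
  simp only [Pi.add_apply, Pi.smul_apply, smul_eq_mul]
  have : (1 - ε) * (shearerF ((S G U W u + ε * Q) / (W u * (1 + ε * S G U W u))) - δ)
    ≤ (1 - ε) * c' u := mul_le_mul_of_nonneg_left hcov (by linarith)
  linarith

lemma step (G : SimpleGraph V) [DecidableRel G.Adj] (hG : G.CliqueFree 3)
    (U : Finset V) (hU : U.Nonempty) (IH : ∀ U' ⊂ U, Good G U' 0) {δ ε : ℝ} (he : 0 < ε)
    (he1 : ε ≤ 1) (hA : Good G U δ) : Good G U ((1 - ε) * δ + 2 * ε ^ 2) := by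
  intro W hW
  have hM : 0 < ∑ x ∈ U, W x := Finset.sum_pos (fun x _ => hW x) hU
  set M := ∑ x ∈ U, W x with hMdef
  obtain ⟨c, hc, h⟩ := step_normalized G hG U IH he he1 hA (fun x => W x / M)
    (fun x => div_pos (hW x) hM) (by rw [← Finset.sum_div]; exact div_self hM.ne')
  refine ⟨c, hc, fun u hu => ?_⟩
  have h1 := h u hu
  have : S G U (fun x => W x / M) u / (W u / M) = S G U W u / W u := by
    have : S G U (fun x => W x / M) u = S G U W u / M := by
      unfold S
      rw [Finset.sum_div]
      apply Finset.sum_congr rfl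
      intro x _
      ring
    rw [this]
    have := (hW u).ne'
    field_simp
  simpa only [this] using h1

lemma R_compact (G : SimpleGraph V) (U : Finset V) : IsCompact (R G U) := by
  apply Set.Finite.isCompact_convexHull
  apply (Set.finite_range (ind : Finset V → V → ℝ)).subset
  rintro _ ⟨I, -, -, rfl⟩
  exact ⟨I, rfl⟩

lemma empty_mem (G : SimpleGraph V) (U : Finset V) : (0 : V → ℝ) ∈ R G U := by
  apply subset_convexHull
  refine ⟨∅, by simp, by simp [IsIndepFinset], ?_⟩
  funext x
  simp [ind]

lemma shearerF_le_one {x : ℝ} (hx : 0 ≤ x) : shearerF x ≤ 1 := by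
  rw [← shearerF_zero]
  exact shearerF_anti le_rfl hx

lemma good_one (G : SimpleGraph V) [DecidableRel G.Adj] (U : Finset V) : Good G U 1 := by
  intro W hW
  refine ⟨0, empty_mem G U, fun u _ => ?_⟩
  have := shearerF_le_one (div_nonneg (S_nonneg G U hW u) (hW u).le)
  simpa using this

lemma good_mono {G : SimpleGraph V} [DecidableRel G.Adj] {U : Finset V} {δ δ' : ℝ}
    (h : Good G U δ) (hd : δ ≤ δ') : Good G U δ' := by
  intro W hW
  obtain ⟨c, hc, h1⟩ := h W hW
  exact ⟨c, hc, fun u hu => by linarith [h1 u hu]⟩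

lemma good_of_all {G : SimpleGraph V} [DecidableRel G.Adj] {U : Finset V}
    (h : ∀ δ > 0, Good G U δ) : Good G U 0 := by
  intro W hW
  have hn : ∀ n : ℕ, ∃ c ∈ R G U, ∀ u ∈ U,
      shearerF (S G U W u / W u) - 1 / ((n : ℝ) + 1) ≤ c u :=
    fun n => h _ (by positivity) W hW
  choose c hc h1 using hn
  obtain ⟨a, ha, φ, hφ, hlim⟩ := (R_compact G U).tendsto_subseq hc
  refine ⟨a, ha, fun u hu => ?_⟩
  have l1 : Filter.Tendsto (fun n => c (φ n) u) Filter.atTop (nhds (a u)) :=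
    (tendsto_pi_nhds.mp hlim) u
  have l2 : Filter.Tendsto (fun n : ℕ => shearerF (S G U W u / W u) - 1 / ((φ n : ℝ) + 1))
      Filter.atTop (nhds (shearerF (S G U W u / W u) - 0)) :=
    tendsto_const_nhds.sub
      ((tendsto_one_div_add_atTop_nhds_zero_nat (𝕜 := ℝ)).comp hφ.tendsto_atTop)
  exact le_of_tendsto_of_tendsto' l2 l1 (fun n => h1 (φ n) u hu)

lemma good_zero (G : SimpleGraph V) [DecidableRel G.Adj] (hG : G.CliqueFree 3)
    (U : Finset V) : Good G U 0 := by
  induction U using Finset.strongInduction with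
  | H U IH =>
    rcases U.eq_empty_or_nonempty with rfl | hU
    · intro W _
      exact ⟨0, empty_mem G _, by simp⟩
    apply good_of_all
    set T : Set ℝ := {δ | 0 ≤ δ ∧ Good G U δ} with hT
    have hTne : T.Nonempty := ⟨1, zero_le_one, good_one G U⟩
    have hTb : BddBelow T := ⟨0, fun δ h => h.1⟩
    set d := sInf T with hd
    have hd0 : 0 ≤ d := le_csInf hTne fun δ h => h.1
    have key : ∀ ε : ℝ, 0 < ε → ε < 1 → d ≤ 2 * ε := by
      intro ε he he1
      have h1 : (d - 2 * ε ^ 2) / (1 - ε) ≤ d := by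
        apply le_csInf hTne
        intro δ hδ
        rw [div_le_iff₀ (by linarith)]
        have : d ≤ (1 - ε) * δ + 2 * ε ^ 2 := csInf_le hTb
          ⟨by have := hδ.1; have : 0 ≤ (1 - ε) * δ := mul_nonneg (by linarith) this
              positivity,
            step G hG U hU IH he he1.le hδ.2⟩
        linarith
      rw [div_le_iff₀ (by linarith)] at h1
      nlinarith
    have hd1 : d ≤ 0 := by
      by_contra hcon
      push Not at hcon
      have h1 : d ≤ 1 := csInf_le hTb ⟨zero_le_one, good_one G U⟩
      have := key (d / 4) (by linarith) (by linarith)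
      linarith
    intro δ hδ
    obtain ⟨δ', h1, h2⟩ := exists_lt_of_csInf_lt hTne (lt_of_le_of_lt hd1 hδ)
    exact good_mono h1.2 h2.le

/-- elements of the polytope come from probability distributions -/
lemma R_dist {G : SimpleGraph V} {U : Finset V} {c : V → ℝ} (hc : c ∈ R G U) :
    ∃ p : Finset V → ℝ,
      (∀ I, 0 ≤ p I) ∧
      (∀ I, p I ≠ 0 → IsIndepFinset G I) ∧
      (∑ I : Finset V, p I) = 1 ∧
      ∀ v : V, c v = ∑ I ∈ Finset.univ.filter (fun I : Finset V => v ∈ I), p I := by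
  revert hc
  suffices h : R G U ⊆ {c | ∃ p : Finset V → ℝ,
      (∀ I, 0 ≤ p I) ∧
      (∀ I, p I ≠ 0 → IsIndepFinset G I) ∧
      (∑ I : Finset V, p I) = 1 ∧
      ∀ v : V, c v = ∑ I ∈ Finset.univ.filter (fun I : Finset V => v ∈ I), p I} from
    fun hc => h hc
  apply convexHull_min
  · rintro _ ⟨J, -, hJ, rfl⟩
    refine ⟨fun I => if I = J then 1 else 0, ?_, ?_, ?_, ?_⟩
    · intro I; dsimp only; split_ifs <;> norm_num
    · intro I hI
      have : I = J := by by_contra h; simp [h] at hI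
      rwa [this]
    · simp
    · intro v
      simp [ind, Finset.sum_ite_eq']
  · rintro c1 ⟨p1, a1, b1, s1, e1⟩ c2 ⟨p2, a2, b2, s2, e2⟩ s t hs ht hst
    refine ⟨fun I => s * p1 I + t * p2 I, ?_, ?_, ?_, ?_⟩
    · intro I
      have := a1 I
      have := a2 I
      positivity
    · intro I hI
      by_cases h1 : p1 I = 0
      · by_cases h2 : p2 I = 0
        · simp [h1, h2] at hI
        · exact b2 I h2
      · exact b1 I h1
    · rw [Finset.sum_add_distrib, ← Finset.mul_sum, ← Finset.mul_sum, s1, s2]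
      linarith
    · intro v
      rw [Finset.sum_add_distrib, ← Finset.mul_sum, ← Finset.mul_sum, ← e1, ← e2]
      simp

end Graph

/-- fractional Molloy bound: every finite triangle-free graph with
maximum degree `Δ` has a probability distribution on its independent sets covering every
vertex with probability at least `f(Δ)`; in particular `χ_f(G) ≤ 1/f(Δ)`. -/
theorem local_shearer_maxDegree {V : Type*} [Fintype V] [DecidableEq V]
    (G : SimpleGraph V) [DecidableRel G.Adj] (hG : G.CliqueFree 3) :
    ∃ p : Finset V → ℝ,
      (∀ I, 0 ≤ p I) ∧
      (∀ I, p I ≠ 0 → IsIndepFinset G I) ∧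
      (∑ I : Finset V, p I) = 1 ∧
      ∀ v : V,
        shearerF (G.maxDegree) ≤
          ∑ I ∈ Finset.univ.filter (fun I : Finset V => v ∈ I), p I := by
  obtain ⟨c, hc, h⟩ := good_zero G hG Finset.univ (fun _ => 1) (fun _ => one_pos)
  obtain ⟨p, h1, h2, h3, h4⟩ := R_dist hc
  refine ⟨p, h1, h2, h3, fun v => ?_⟩
  rw [← h4 v]
  have h5 := h v (Finset.mem_univ v)
  have h6 : S G Finset.univ (fun _ => (1 : ℝ)) v = G.degree v := by
    simp [S, adj, ← SimpleGraph.card_neighborFinset_eq_degree,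
      SimpleGraph.neighborFinset_eq_filter]
  rw [h6, div_one, sub_zero] at h5
  refine le_trans (shearerF_anti (Nat.cast_nonneg _) ?_) h5
  exact_mod_cast G.degree_le_maxDegree v
end
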